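/- arXiv:1706.03740 — 2 statements merged into one kernel-verified Lean document; each statement's English description precedes it below -/
import Mathlib

section
/- Cross-intersection theorem. For all D,C,k ∈ ℕ there is θ₁ > 0 such that for all κ,γ,ε ∈ (0,θ₁) there is θ₂ > 0 such that for all ζ ∈ (0,θ₂) there exist δ₀ > 0 and n₀ such that for all n ≥ n₀ and δ ∈ (0,δ₀] the following holds. Let R = (R_1,…,R_D) with all R_d > 0 and max_d R_d < n^C, and suppose: (1) μ_q is a κ-bounded product measure on ({0,1}×{0,1})ⁿ with marginals (μ_{p₁}, μ_{p₂}); (2) 𝒱 = (v_i : i∈[n]) is an R-bounded family of vectors in ℤ^D that is γ-robustly (R,k)-generating; (3) w ∈ ℤ^D with ‖w − 𝒱_∩(μ_q)‖_R < ζn. Then any 𝒜₁, 𝒜₂ ⊆ {0,1}ⁿ with μ_{p₁}(𝒜₁)·μ_{p₂}(𝒜₂) > (1−δ)ⁿ satisfy μ_q((𝒜₁ × 𝒜₂)^{𝒱_∩}_w) > (1−ε)ⁿ. -/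
open Finset

noncomputable section

/-- The `R`-scaled sup-norm `max_d |v d| / R d`. -/
noncomputable def rnorm {D : ℕ} (R : Fin D → ℝ) (v : Fin D → ℝ) : ℝ :=
  ⨆ d, |v d| / R d

/-- Product measure on `Jⁿ` from weights `p`. -/
def prodMeas {n : ℕ} {J : Type*} (p : Fin n → J → ℝ) (a : Fin n → J) : ℝ :=
  ∏ i, p i (a i)

/-- Measure of a set under a (finitely supported) measure `μ`. -/
noncomputable def smeas {α : Type*} [Fintype α] (μ : α → ℝ) (A : Set α) : ℝ :=
  ∑ x, A.indicator μ x

/-- The array `𝒱_∩` associated to a family of vectors `v`. -/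
def capArr {n D : ℕ} (v : Fin n → Fin D → ℤ) (i : Fin n) (jj : Bool × Bool) (d : Fin D) : ℤ :=
  if jj.1 ∧ jj.2 then v i d else 0

/-- Evaluation of an `(n,J)`-array at `a ∈ Jⁿ`. -/
def arrEval {n D : ℕ} {J : Type*} (V : Fin n → J → Fin D → ℤ)
    (a : Fin n → J) (d : Fin D) : ℤ :=
  ∑ i, V i (a i) d

/-- Expectation `𝒱(μ) d = E_{a∼μ} 𝒱(a) d`. -/
noncomputable def arrExp {n D : ℕ} {J : Type*} [Fintype J]
    (V : Fin n → J → Fin D → ℤ) (μ : (Fin n → J) → ℝ) (d : Fin D) : ℝ :=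
  ∑ a : Fin n → J, μ a * (arrEval V a d : ℝ)

/-- `v` is `γ`-robustly `(R,k)`-generating. -/
def RobustlyGenerating {n D : ℕ} (γ : ℝ) (R : Fin D → ℝ) (k : ℕ)
    (v : Fin n → Fin D → ℤ) : Prop :=
  ∀ u : Fin D → ℤ, rnorm R (fun d => (u d : ℝ)) ≤ 1 →
    ∀ T : Finset (Fin n), (T.card : ℝ) ≤ γ * n →
      ∃ S S' : Finset (Fin n), Disjoint S S' ∧ Disjoint S T ∧ Disjoint S' T ∧
        S.card + S'.card ≤ k ∧ ∀ d, u d = ∑ i ∈ S, v i d - ∑ i ∈ S', v i d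

/-! ### Product measures -/

lemma rnorm_le_iff {D : ℕ} {R : Fin D → ℝ} (hR : ∀ d, 0 < R d) {v : Fin D → ℝ} {r : ℝ}
    (hr : 0 ≤ r) : rnorm R v ≤ r ↔ ∀ d, |v d| ≤ r * R d := by
  unfold rnorm
  constructor
  · intro h d
    rw [← div_le_iff₀ (hR d)]
    exact (le_ciSup (f := fun d => |v d| / R d) (Set.finite_range _).bddAbove d).trans h
  · intro h
    exact Real.iSup_le (fun d => (div_le_iff₀ (hR d)).2 (h d)) hr

lemma prodMeas_nonneg {n : ℕ} {J : Type*} {p : Fin n → J → ℝ} (hp : ∀ i j, 0 ≤ p i j) (a : Fin n → J) :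
    0 ≤ prodMeas p a :=
  Finset.prod_nonneg fun i _ => hp i _

section Measure

variable {n : ℕ} {J : Type*} [Fintype J]

/-- A family of probability weights, all bounded below by `κ`. -/
structure IsWeight (κ : ℝ) (p : Fin n → J → ℝ) : Prop where
  sum_eq : ∀ i, ∑ j, p i j = 1
  le : ∀ i j, κ ≤ p i j

lemma IsWeight.nonneg {κ : ℝ} (hκ : 0 < κ) {p : Fin n → J → ℝ} (hp : IsWeight κ p) (i j) :
    0 ≤ p i j :=
  hκ.le.trans (hp.le i j)

lemma sum_prod_pi [DecidableEq J] (p : Fin n → J → ℝ) :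
    ∑ a : Fin n → J, ∏ i, p i (a i) = ∏ i, ∑ j, p i j := by
  rw [Finset.prod_univ_sum]
  simp

lemma sum_prodMeas [DecidableEq J] {p : Fin n → J → ℝ} (hp : ∀ i, ∑ j, p i j = 1) :
    ∑ a : Fin n → J, prodMeas p a = 1 := by
  unfold prodMeas
  rw [sum_prod_pi]
  simp [hp]

lemma smeas_mono {α : Type*} [Fintype α] {μ : α → ℝ} (hμ : ∀ a, 0 ≤ μ a) {A B : Set α}
    (h : A ⊆ B) : smeas μ A ≤ smeas μ B :=
  Finset.sum_le_sum fun a _ => Set.indicator_le_indicator_of_subset h hμ a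

lemma smeas_nonneg {α : Type*} [Fintype α] {μ : α → ℝ} (hμ : ∀ a, 0 ≤ μ a) (A : Set α) :
    0 ≤ smeas μ A :=
  Finset.sum_nonneg fun a _ => Set.indicator_nonneg (fun a _ => hμ a) a

lemma smeas_le_sum {α : Type*} [Fintype α] {μ : α → ℝ} (hμ : ∀ a, 0 ≤ μ a) (A : Set α) :
    smeas μ A ≤ ∑ a, μ a :=
  Finset.sum_le_sum fun a _ => Set.indicator_le_self' (fun a _ => hμ a) a

lemma smeas_union_add_inter {α : Type*} [Fintype α] (μ : α → ℝ) (A B : Set α) :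
    smeas μ (A ∪ B) + smeas μ (A ∩ B) = smeas μ A + smeas μ B := by
  unfold smeas
  rw [← Finset.sum_add_distrib, ← Finset.sum_add_distrib]
  refine Finset.sum_congr rfl fun a _ => ?_
  exact Set.indicator_union_add_inter_apply μ A B a

lemma smeas_union_le {α : Type*} [Fintype α] {μ : α → ℝ} (hμ : ∀ a, 0 ≤ μ a) (A B : Set α) :
    smeas μ (A ∪ B) ≤ smeas μ A + smeas μ B := by
  have := smeas_union_add_inter μ A B
  have := smeas_nonneg hμ (A ∩ B)
  linarith

/-- The slice of `A` obtained by fixing the `i`-th coordinate to be `j`. -/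
def fixCoord (i : Fin n) (j : J) (A : Set (Fin n → J)) : Set (Fin n → J) :=
  {a | Function.update a i j ∈ A}

lemma sum_update [DecidableEq J] {p : Fin n → J → ℝ} (i : Fin n) (hp : ∑ j, p i j = 1)
    (f : (Fin n → J) → ℝ) :
    ∑ j, p i j * ∑ a, prodMeas p a * f (Function.update a i j) = ∑ a, prodMeas p a * f a := by
  let e : ((Fin n → J) × J) → ((Fin n → J) × J) := fun x => (Function.update x.1 i x.2, x.1 i)
  have he : Function.Involutive e := by
    rintro ⟨a, j⟩
    simp [e]
  have hw : ∀ x : (Fin n → J) × J, prodMeas p (e x).1 * p i (e x).2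
      = prodMeas p x.1 * p i x.2 := by
    rintro ⟨a, j⟩
    simp only [e, prodMeas]
    rw [← Finset.mul_prod_erase univ _ (Finset.mem_univ i),
      ← Finset.mul_prod_erase univ (fun l => p l (a l)) (Finset.mem_univ i)]
    rw [Finset.prod_congr rfl (g := fun l => p l (a l))]
    · simp; ring
    · intro l hl
      rw [Function.update_of_ne (Finset.ne_of_mem_erase hl)]
  have h1 : ∑ x : (Fin n → J) × J, prodMeas p x.1 * p i x.2 * f (e x).1
      = ∑ x : (Fin n → J) × J, prodMeas p x.1 * p i x.2 * f x.1 := by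
    rw [← Equiv.sum_comp (he.toPerm e)]
    refine Finset.sum_congr rfl fun x _ => ?_
    change prodMeas p (e x).1 * p i (e x).2 * f (e (e x)).1 = _
    rw [he x, hw]
  rw [Fintype.sum_prod_type, Fintype.sum_prod_type] at h1
  have h2 : ∑ a, ∑ j, prodMeas p a * p i j * f a = ∑ a, prodMeas p a * f a := by
    refine Finset.sum_congr rfl fun a _ => ?_
    rw [← Finset.sum_mul, ← Finset.mul_sum, hp, mul_one]
  rw [← h2]
  simp only at h1
  rw [← h1, Finset.sum_comm]
  refine Finset.sum_congr rfl fun a _ => ?_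
  rw [Finset.mul_sum]
  refine Finset.sum_congr rfl fun j _ => ?_
  simp only [e]
  ring

lemma smeas_eq_sum_ite {α : Type*} [Fintype α] (μ : α → ℝ) (A : Set α) :
    smeas μ A = ∑ a, μ a * A.indicator 1 a := by
  unfold smeas
  refine Finset.sum_congr rfl fun a _ => ?_
  by_cases h : a ∈ A <;> simp [h]

lemma smeas_eq_sum_fixCoord [DecidableEq J] {p : Fin n → J → ℝ} (i : Fin n)
    (hp : ∑ j, p i j = 1) (A : Set (Fin n → J)) :
    smeas (prodMeas p) A = ∑ j, p i j * smeas (prodMeas p) (fixCoord i j A) := by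
  rw [smeas_eq_sum_ite, ← sum_update i hp]
  refine Finset.sum_congr rfl fun j _ => ?_
  rw [smeas_eq_sum_ite]
  rfl

/-- Passing to the cylinder over `U` increases the measure by a factor at most `κ ^ (-|U|)`. -/
lemma pow_mul_smeas_cylinder_le [DecidableEq J] {κ : ℝ} (hκ : 0 < κ) {p : Fin n → J → ℝ}
    (hp : IsWeight κ p) (X : Set (Fin n → J)) (U : Finset (Fin n)) :
    κ ^ U.card * smeas (prodMeas p) {r | ∃ r' ∈ X, ∀ i ∉ U, r' i = r i}
      ≤ smeas (prodMeas p) X := by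
  have h0 := prodMeas_nonneg (hp.nonneg hκ)
  induction U using Finset.induction_on with
  | empty =>
    simp only [card_empty, pow_zero, one_mul]
    refine smeas_mono h0 ?_
    rintro r ⟨r', hr', h⟩
    rwa [show r = r' from funext fun i => (h i (by simp)).symm]
  | insert i U hi ih =>
    refine le_trans ?_ ih
    rw [card_insert_of_notMem hi, pow_succ, mul_assoc]
    refine mul_le_mul_of_nonneg_left ?_ (by positivity)
    set Y : Set (Fin n → J) := {r | ∃ r' ∈ X, ∀ i ∉ U, r' i = r i}
    rw [smeas_eq_sum_fixCoord i (hp.sum_eq i) Y]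
    have h1 : smeas (prodMeas p) {r | ∃ r' ∈ X, ∀ l ∉ insert i U, r' l = r l}
        ≤ ∑ j, smeas (prodMeas p) (fixCoord i j Y) := by
      unfold smeas
      rw [Finset.sum_comm]
      refine Finset.sum_le_sum fun r _ => ?_
      by_cases hr : r ∈ {r | ∃ r' ∈ X, ∀ l ∉ insert i U, r' l = r l}
      · rw [Set.indicator_of_mem hr]
        obtain ⟨r', hr', h⟩ := hr
        have hmem : r ∈ fixCoord i (r' i) Y := by
          refine ⟨r', hr', fun l hl => ?_⟩
          by_cases hli : l = i
          · subst hli; simp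
          · rw [Function.update_of_ne hli]
            exact h l (by simp [hli, hl])
        calc prodMeas p r = (fixCoord i (r' i) Y).indicator (prodMeas p) r :=
              (Set.indicator_of_mem hmem _).symm
          _ ≤ _ := Finset.single_le_sum
              (f := fun j => (fixCoord i j Y).indicator (prodMeas p) r)
              (fun j _ => Set.indicator_nonneg (fun a _ => h0 a) r) (Finset.mem_univ (r' i))
      · rw [Set.indicator_of_notMem hr]
        exact Finset.sum_nonneg fun j _ => Set.indicator_nonneg (fun a _ => h0 a) r
    calc _ ≤ κ * ∑ j, smeas (prodMeas p) (fixCoord i j Y) := mul_le_mul_of_nonneg_left h1 hκ.le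
      _ = ∑ j, κ * smeas (prodMeas p) (fixCoord i j Y) := Finset.mul_sum ..
      _ ≤ _ := Finset.sum_le_sum fun j _ =>
          mul_le_mul_of_nonneg_right (hp.le i j) (smeas_nonneg h0 _)

lemma pow_mul_smeas_le_of_le {p p' : Fin n → J → ℝ} {c : ℝ} (hc : 0 ≤ c)
    (hp' : ∀ i j, 0 ≤ p' i j) (h : ∀ i j, c * p' i j ≤ p i j) (X : Set (Fin n → J)) :
    c ^ n * smeas (prodMeas p') X ≤ smeas (prodMeas p) X := by
  unfold smeas
  rw [Finset.mul_sum]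
  refine Finset.sum_le_sum fun a _ => ?_
  by_cases ha : a ∈ X
  · rw [Set.indicator_of_mem ha, Set.indicator_of_mem ha]
    unfold prodMeas
    calc c ^ n * ∏ i, p' i (a i) = ∏ i, c * p' i (a i) := by
          rw [Finset.prod_mul_distrib]; simp
      _ ≤ _ := Finset.prod_le_prod (fun i _ => mul_nonneg hc (hp' _ _)) fun i _ => h _ _
  · simp [ha]

end Measure

/-! ### Shrinking the families one coordinate at a time -/

lemma exp_neg_two_mul_le {x : ℝ} (h0 : 0 ≤ x) (h1 : x ≤ 1 / 2) :
    Real.exp (-(2 * x)) ≤ 1 - x := by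
  rw [Real.exp_neg, inv_le_comm₀ (Real.exp_pos _) (by linarith)]
  have h2 := Real.add_one_le_exp (2 * x)
  refine le_trans ?_ h2
  rw [inv_le_iff_one_le_mul₀ (by linarith)]
  nlinarith

lemma exp_le_one_add_two_mul {x : ℝ} (h0 : 0 ≤ x) (h1 : x ≤ 1 / 2) :
    Real.exp x ≤ 1 + 2 * x := by
  have h2 : 1 - x ≤ Real.exp (-x) := by linarith [Real.add_one_le_exp (-x)]
  have h3 : Real.exp x * Real.exp (-x) = 1 := by rw [← Real.exp_add]; simp
  nlinarith [Real.exp_pos x, Real.exp_pos (-x)]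

lemma lower_of_upper {κ t p₀ p₁ f₀ f₁ f : ℝ} (ht : 0 ≤ t) (h₀ : κ ≤ p₀) (h₁ : κ ≤ p₁)
    (hκ : 0 < κ) (hp : p₀ + p₁ = 1) (hf : p₀ * f₀ + p₁ * f₁ = f) (hf0 : 0 ≤ f)
    (hf₁ : f₁ ≤ (1 + κ * t) * f) : (1 - t) * f ≤ f₀ := by
  have h2 : p₀ * ((1 - t) * f) ≤ p₀ * f₀ := by
    have h3 : p₁ * f₁ ≤ p₁ * ((1 + κ * t) * f) :=
      mul_le_mul_of_nonneg_left hf₁ (by linarith)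
    have h4 : p₁ * (κ * t * f) ≤ p₀ * (t * f) := by
      have h5 : 0 ≤ t * f := mul_nonneg ht hf0
      have h6 : p₁ * κ ≤ p₀ := by nlinarith
      nlinarith
    have h7 : f = p₀ * f + p₁ * f := by rw [← add_mul, hp, one_mul]
    nlinarith
  exact le_of_mul_le_mul_left h2 (by linarith)

lemma product_lower {κ t p₀ p₁ r₀ r₁ f₀ f₁ f fu fi g₀ g₁ g : ℝ} (hκ : 0 < κ) (ht : 0 ≤ t)
    (ht1 : t ≤ 1 / 10) (hp₀ : κ ≤ p₀) (hp₁ : κ ≤ p₁) (hp : p₀ + p₁ = 1)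
    (hr₀ : κ ≤ r₀) (hr₁ : κ ≤ r₁) (hr : r₀ + r₁ = 1)
    (hf : p₀ * f₀ + p₁ * f₁ = f) (hg : r₀ * g₀ + r₁ * g₁ = g)
    (hf0 : 0 < f) (hg0 : 0 < g)
    (hfi0 : 0 ≤ fi) (hg₀0 : 0 ≤ g₀) (hg₁0 : 0 ≤ g₁) (hf₀0 : 0 ≤ f₀) (hf₁0 : 0 ≤ f₁)
    (hfi : fu + fi = f₀ + f₁)
    (h00 : f₀ * g₀ ≤ (1 + κ * t) * (f * g)) (h01 : f₀ * g₁ ≤ (1 + κ * t) * (f * g))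
    (h10 : f₁ * g₀ ≤ (1 + κ * t) * (f * g)) (h11 : f₁ * g₁ ≤ (1 + κ * t) * (f * g))
    (hu : fu * g₀ ≤ (1 + κ * t) * (f * g)) :
    (1 - 5 * t) * (f * g) ≤ fi * g₁ := by
  have hκ1 : κ ≤ 1 := by linarith
  have key : ∀ {a₀ a₁ a b : ℝ}, ∀ {w₀ w₁ : ℝ}, κ ≤ w₀ → κ ≤ w₁ → w₀ + w₁ = 1 →
      w₀ * a₀ + w₁ * a₁ = a → 0 < a → 0 ≤ b → ∀ {c}, a₀ * b ≤ c * a → a₁ * b ≤ c * a →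
      b ≤ c := by
    intro a₀ a₁ a b w₀ w₁ h₀ h₁ hw ha ha0 hb c hc₀ hc₁
    have : a * b ≤ a * c := by
      calc a * b = w₀ * (a₀ * b) + w₁ * (a₁ * b) := by rw [← ha]; ring
        _ ≤ w₀ * (c * a) + w₁ * (c * a) := by
          gcongr <;> linarith
        _ = a * c := by rw [← add_mul, hw]; ring
    exact le_of_mul_le_mul_left this ha0
  have G₀ : g₀ ≤ (1 + κ * t) * g :=
    key hp₀ hp₁ hp hf hf0 hg₀0 (by linarith) (by linarith)
  have G₁ : g₁ ≤ (1 + κ * t) * g :=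
    key hp₀ hp₁ hp hf hf0 hg₁0 (by linarith) (by linarith)
  have F₀ : f₀ ≤ (1 + κ * t) * f :=
    key hr₀ hr₁ hr hg hg0 hf₀0 (by linarith) (by linarith)
  have F₁ : f₁ ≤ (1 + κ * t) * f :=
    key hr₀ hr₁ hr hg hg0 hf₁0 (by linarith) (by linarith)
  have G₀' : (1 - t) * g ≤ g₀ := lower_of_upper ht hr₀ hr₁ hκ hr hg hg0.le G₁
  have G₁' : (1 - t) * g ≤ g₁ :=
    lower_of_upper ht hr₁ hr₀ hκ (by linarith) (by linarith) hg0.le G₀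
  have F₀' : (1 - t) * f ≤ f₀ := lower_of_upper ht hp₀ hp₁ hκ hp hf hf0.le F₁
  have F₁' : (1 - t) * f ≤ f₁ :=
    lower_of_upper ht hp₁ hp₀ hκ (by linarith) (by linarith) hf0.le F₀
  have hfu : fu * (1 - t) ≤ (1 + t) * f := by
    by_cases hfu0 : fu ≤ 0
    · have : fu * (1 - t) ≤ 0 := mul_nonpos_of_nonpos_of_nonneg hfu0 (by linarith)
      nlinarith
    · have h1 : fu * ((1 - t) * g) ≤ fu * g₀ :=
        mul_le_mul_of_nonneg_left G₀' (by linarith)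
      have h2 : (1 + κ * t) * (f * g) ≤ (1 + t) * (f * g) := by
        gcongr
        nlinarith
      have h3 : g * (fu * (1 - t)) ≤ g * ((1 + t) * f) := by nlinarith
      exact le_of_mul_le_mul_left h3 hg0
  have h1 : (1 - 5 * t) * f ≤ fi * (1 - t) := by
    have h2 : (1 - t) * fi = (1 - t) * (f₀ + f₁) - fu * (1 - t) := by rw [← hfi]; ring
    have h3 : (1 - t) * (2 * ((1 - t) * f)) ≤ (1 - t) * (f₀ + f₁) :=
      mul_le_mul_of_nonneg_left (by linarith) (by linarith)
    nlinarith [mul_nonneg (sq_nonneg t) hf0.le]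
  calc (1 - 5 * t) * (f * g) = ((1 - 5 * t) * f) * g := by ring
    _ ≤ fi * (1 - t) * g := by gcongr
    _ = fi * ((1 - t) * g) := by ring
    _ ≤ fi * g₁ := mul_le_mul_of_nonneg_left G₁' hfi0

section Reach

variable {n D : ℕ}

/-- The contribution of the coordinates in `I` to the intersection vector of `a` and `b`. -/
def capOn (v : Fin n → Fin D → ℤ) (I : Finset (Fin n)) (a b : Fin n → Bool) : Fin D → ℤ :=
  ∑ i ∈ I, if a i = true ∧ b i = true then v i else 0

/-- Each pair in `F' × G'` can be changed on `I` to a pair in `F × G` whose intersection vector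
on `I` is `t`. -/
def Reach (v : Fin n → Fin D → ℤ) (I : Finset (Fin n)) (F G F' G' : Set (Fin n → Bool))
    (t : Fin D → ℤ) : Prop :=
  ∀ a ∈ F', ∀ b ∈ G', ∃ a' ∈ F, ∃ b' ∈ G,
    (∀ i ∉ I, a' i = a i ∧ b' i = b i) ∧ capOn v I a' b' = t

lemma capOn_congr {v : Fin n → Fin D → ℤ} {I : Finset (Fin n)} {a b a' b' : Fin n → Bool}
    (h : ∀ i ∈ I, a' i = a i ∧ b' i = b i) : capOn v I a' b' = capOn v I a b := by
  refine Finset.sum_congr rfl fun i hi => ?_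
  rw [(h i hi).1, (h i hi).2]

lemma Reach.trans {v : Fin n → Fin D → ℤ} {I I' : Finset (Fin n)}
    {F G F' G' F'' G'' : Set (Fin n → Bool)} {t t' : Fin D → ℤ} (h : Reach v I F G F' G' t)
    (h' : Reach v I' F' G' F'' G'' t') (hd : Disjoint I I') :
    Reach v (I ∪ I') F G F'' G'' (t + t') := by
  intro a ha b hb
  obtain ⟨a', ha', b', hb', h1, h2⟩ := h' a ha b hb
  obtain ⟨a₁, ha₁, b₁, hb₁, h3, h4⟩ := h a' ha' b' hb'
  refine ⟨a₁, ha₁, b₁, hb₁, ?_, ?_⟩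
  · intro i hi
    rw [Finset.mem_union, not_or] at hi
    rw [(h3 i hi.1).1, (h3 i hi.1).2]
    exact h1 i hi.2
  · have h5 : capOn v I' a₁ b₁ = capOn v I' a' b' :=
      capOn_congr fun i hi => h3 i (Finset.disjoint_right.1 hd hi)
    rw [← h4, ← h2, ← h5]
    exact Finset.sum_union hd

lemma reach_refl (v : Fin n → Fin D → ℤ) (F G : Set (Fin n → Bool)) :
    Reach v ∅ F G F G 0 := by
  intro a ha b hb
  exact ⟨a, ha, b, hb, fun i _ => ⟨rfl, rfl⟩, by simp [capOn]⟩

lemma reach_update (v : Fin n → Fin D → ℤ) {i : Fin n} {F G F' G' : Set (Fin n → Bool)}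
    {x y : Bool} (h : ∀ a ∈ F', ∀ b ∈ G', Function.update a i x ∈ F ∧ Function.update b i y ∈ G) :
    Reach v {i} F G F' G' (if x = true ∧ y = true then v i else 0) := by
  intro a ha b hb
  refine ⟨_, (h a ha b hb).1, _, (h a ha b hb).2, fun l hl => ?_, by simp [capOn]⟩
  have : l ≠ i := by simpa using hl
  simp [Function.update_of_ne this]

lemma reach_single {κ τ : ℝ} (hκ : 0 < κ) (hτ : 0 ≤ τ) (hτκ : τ ≤ κ / 20)
    {p r : Fin n → Bool → ℝ} (hp : IsWeight κ p) (hr : IsWeight κ r)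
    (v : Fin n → Fin D → ℤ) (i : Fin n) (F G : Set (Fin n → Bool)) :
    (∃ F' G' t, Reach v {i} F G F' G' t ∧
      Real.exp τ * (smeas (prodMeas p) F * smeas (prodMeas r) G)
        ≤ smeas (prodMeas p) F' * smeas (prodMeas r) G') ∨
    ∃ F' G', Reach v {i} F G F' G' 0 ∧ Reach v {i} F G F' G' (v i) ∧
      Real.exp (-(20 / κ * τ)) * (smeas (prodMeas p) F * smeas (prodMeas r) G)
        ≤ smeas (prodMeas p) F' * smeas (prodMeas r) G' := by
  have hp0 := prodMeas_nonneg (hp.nonneg hκ)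
  have hr0 := prodMeas_nonneg (hr.nonneg hκ)
  by_contra! hcon
  obtain ⟨hA, hB⟩ := hcon
  have hps := hp.sum_eq i
  have hrs := hr.sum_eq i
  have hf := smeas_eq_sum_fixCoord i hps F
  have hg := smeas_eq_sum_fixCoord i hrs G
  rw [Fintype.sum_bool] at hps hrs hf hg
  have hslice : ∀ x y, smeas (prodMeas p) (fixCoord i x F) * smeas (prodMeas r) (fixCoord i y G)
      < Real.exp τ * (smeas (prodMeas p) F * smeas (prodMeas r) G) := fun x y =>
    hA _ _ _ (reach_update v fun a ha b hb => ⟨ha, hb⟩)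
  have hunion : smeas (prodMeas p) (fixCoord i true F ∪ fixCoord i false F) *
      smeas (prodMeas r) (fixCoord i false G)
      < Real.exp τ * (smeas (prodMeas p) F * smeas (prodMeas r) G) := by
    refine hA _ _ 0 ?_
    rintro a (ha | ha) b hb
    · simpa using reach_update v (i := i) (F := F) (G := G) (F' := {a}) (G' := {b}) (x := true)
        (y := false) (by rintro _ rfl _ rfl; exact ⟨ha, hb⟩) a rfl b rfl
    · simpa using reach_update v (i := i) (F := F) (G := G) (F' := {a}) (G' := {b}) (x := false)
        (y := false) (by rintro _ rfl _ rfl; exact ⟨ha, hb⟩) a rfl b rfl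
  have hinter := hB (fixCoord i true F ∩ fixCoord i false F) (fixCoord i true G)
    (by simpa using reach_update v (i := i) (F := F) (G := G) (G' := fixCoord i true G)
          (x := false) (y := true) fun a ha b hb => ⟨ha.2, hb⟩)
    (by simpa using reach_update v (i := i) (F := F) (G := G) (G' := fixCoord i true G)
          (x := true) (y := true) fun a ha b hb => ⟨ha.1, hb⟩)
  have hui := smeas_union_add_inter (prodMeas p) (fixCoord i true F) (fixCoord i false F)
  have nn : ∀ A, 0 ≤ smeas (prodMeas p) A := smeas_nonneg hp0
  have nn' : ∀ A, 0 ≤ smeas (prodMeas r) A := smeas_nonneg hr0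
  rcases (nn F).eq_or_lt with h0 | hF
  · rw [← h0] at hinter
    have := mul_nonneg (nn (fixCoord i true F ∩ fixCoord i false F)) (nn' (fixCoord i true G))
    simp at hinter
    linarith
  rcases (nn' G).eq_or_lt with h0 | hG
  · rw [← h0] at hinter
    have := mul_nonneg (nn (fixCoord i true F ∩ fixCoord i false F)) (nn' (fixCoord i true G))
    simp at hinter
    linarith
  have hκ1 : κ ≤ 1 := by linarith [hp.le i true, hp.le i false]
  have hexp : Real.exp τ ≤ 1 + κ * (2 * τ / κ) := by
    rw [mul_div_cancel₀ _ hκ.ne']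
    exact exp_le_one_add_two_mul hτ (by linarith)
  have hfg : 0 ≤ smeas (prodMeas p) F * smeas (prodMeas r) G := by positivity
  have up : ∀ {x}, x < Real.exp τ * (smeas (prodMeas p) F * smeas (prodMeas r) G) →
      x ≤ (1 + κ * (2 * τ / κ)) * (smeas (prodMeas p) F * smeas (prodMeas r) G) :=
    fun hx => hx.le.trans (mul_le_mul_of_nonneg_right hexp hfg)
  have ht1 : 2 * τ / κ ≤ 1 / 10 := by
    rw [div_le_iff₀ hκ]; linarith
  have hlow := product_lower (f₀ := smeas (prodMeas p) (fixCoord i false F))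
    (f₁ := smeas (prodMeas p) (fixCoord i true F)) (g₀ := smeas (prodMeas r) (fixCoord i false G))
    (g₁ := smeas (prodMeas r) (fixCoord i true G)) hκ (by positivity) ht1 (hp.le i false)
    (hp.le i true) (by linarith) (hr.le i false) (hr.le i true) (by linarith)
    (by linarith) (by linarith) hF hG (nn _) (nn' _) (nn' _) (nn _) (nn _)
    (by linarith) (up (hslice _ _)) (up (hslice _ _)) (up (hslice _ _)) (up (hslice _ _))
    (up hunion)
  have hexp2 : Real.exp (-(20 / κ * τ)) ≤ 1 - 5 * (2 * τ / κ) := by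
    have := exp_neg_two_mul_le (x := 5 * (2 * τ / κ)) (by positivity) (by linarith)
    refine le_trans (le_of_eq ?_) this
    congr 1
    ring
  have := mul_le_mul_of_nonneg_right hexp2 hfg
  linarith

lemma reach_finset {κ τ : ℝ} (hκ : 0 < κ) (hτ : 0 ≤ τ)
    {p r : Fin n → Bool → ℝ} (hp : IsWeight κ p) (hr : IsWeight κ r)
    (v : Fin n → Fin D → ℤ) (F G : Set (Fin n → Bool)) (I : Finset (Fin n))
    (hτκ : (20 / κ + 1) ^ I.card * τ ≤ κ / 20) :
    (∃ I' ⊆ I, ∃ F' G' t, Reach v I' F G F' G' t ∧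
      Real.exp τ * (smeas (prodMeas p) F * smeas (prodMeas r) G)
        ≤ smeas (prodMeas p) F' * smeas (prodMeas r) G') ∨
    ∃ F' G', (∀ S ⊆ I, Reach v I F G F' G' (∑ i ∈ S, v i)) ∧
      Real.exp (-(((20 / κ + 1) ^ I.card - 1) * τ)) *
          (smeas (prodMeas p) F * smeas (prodMeas r) G)
        ≤ smeas (prodMeas p) F' * smeas (prodMeas r) G' := by
  induction I using Finset.induction_on with
  | empty =>
    refine Or.inr ⟨F, G, fun S hS => ?_, by simp⟩
    rw [Finset.subset_empty.1 hS]
    simpa using reach_refl v F G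
  | insert i I hi ih =>
    rw [card_insert_of_notMem hi] at hτκ ⊢
    set K := 20 / κ + 1
    have hK : 1 ≤ K := by simp only [K]; linarith [show 0 ≤ 20 / κ by positivity]
    have hKI : (1 : ℝ) ≤ K ^ I.card := one_le_pow₀ hK
    have hle : K ^ I.card * τ ≤ K ^ (I.card + 1) * τ :=
      mul_le_mul_of_nonneg_right (pow_le_pow_right₀ hK (Nat.le_succ _)) hτ
    rcases ih (hle.trans hτκ) with ⟨I', hI', h⟩ | ⟨F', G', hF', hm⟩
    · exact Or.inl ⟨I', hI'.trans (Finset.subset_insert i I), h⟩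
    have hdisj : Disjoint I {i} := by simpa using hi
    have hIi : I ∪ {i} = insert i I := by rw [Finset.union_comm]; rfl
    rcases reach_single hκ (τ := K ^ I.card * τ) (by positivity) (hle.trans hτκ) hp hr v i F' G'
      with ⟨F'', G'', t, ht, hm'⟩ | ⟨F'', G'', h0, h1, hm'⟩
    · refine Or.inl ⟨insert i I, le_rfl, F'', G'', 0 + t, ?_, ?_⟩
      · rw [← hIi]
        exact Reach.trans (by simpa using hF' ∅ (by simp)) ht hdisj
      · refine le_trans ?_ (le_trans (mul_le_mul_of_nonneg_left hm (Real.exp_pos _).le) hm')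
        rw [← mul_assoc (Real.exp _) (Real.exp _), ← Real.exp_add]
        apply le_of_eq
        congr 2
        ring
    · refine Or.inr ⟨F'', G'', fun S hS => ?_, ?_⟩
      · rw [← hIi]
        by_cases hiS : i ∈ S
        · rw [← Finset.sum_erase_add _ _ hiS]
          refine (hF' _ ?_).trans h1 hdisj
          rwa [← Finset.subset_insert_iff]
        · rw [← add_zero (∑ i ∈ S, v i)]
          exact (hF' _ ((Finset.subset_insert_iff_of_notMem hiS).1 hS)).trans h0 hdisj
      · refine le_trans ?_ (le_trans (mul_le_mul_of_nonneg_left hm (Real.exp_pos _).le) hm')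
        rw [← mul_assoc (Real.exp _) (Real.exp _), ← Real.exp_add]
        apply le_of_eq
        congr 2
        simp only [K]
        ring

end Reach

/-! ### Reaching a whole box of intersection vectors -/

section Box

variable {n D : ℕ}

/-- The property `RobustlyGenerating`, with the scaled norms spelled out. -/
def Generating (γ : ℝ) (R : Fin D → ℤ) (k : ℕ) (v : Fin n → Fin D → ℤ) : Prop :=
  ∀ u : Fin D → ℤ, (∀ d, |u d| ≤ R d) → ∀ T : Finset (Fin n), (T.card : ℝ) ≤ γ * n →
    ∃ S S' : Finset (Fin n), Disjoint S S' ∧ Disjoint S T ∧ Disjoint S' T ∧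
      S.card + S'.card ≤ k ∧ u = ∑ i ∈ S, v i - ∑ i ∈ S', v i

lemma RobustlyGenerating.generating {γ : ℝ} {R : Fin D → ℤ} {k : ℕ} {v : Fin n → Fin D → ℤ}
    (hR : ∀ d, 0 < R d) (h : RobustlyGenerating γ (fun d => (R d : ℝ)) k v) :
    Generating γ R k v := by
  intro u hu T hT
  obtain ⟨S, S', h1, h2, h3, h4, h5⟩ := h u
    ((rnorm_le_iff (fun d => by exact_mod_cast hR d) zero_le_one).2 fun d => by
      rw [one_mul]; exact_mod_cast hu d) T hT
  exact ⟨S, S', h1, h2, h3, h4, funext fun d => by simp [h5 d]⟩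

/-- Up to a translation, all vectors between `0` and `N` are reached. -/
def BoxReach (v : Fin n → Fin D → ℤ) (U : Finset (Fin n)) (A₁ A₂ F G : Set (Fin n → Bool))
    (N : Fin D → ℤ) : Prop :=
  ∃ e, ∀ m, 0 ≤ m → m ≤ N → Reach v U A₁ A₂ F G (e + m)

lemma BoxReach.trans {v : Fin n → Fin D → ℤ} {U I : Finset (Fin n)}
    {A₁ A₂ F G F' G' : Set (Fin n → Bool)} {N t : Fin D → ℤ} (h : BoxReach v U A₁ A₂ F G N)
    (h' : Reach v I F G F' G' t) (hd : Disjoint U I) : BoxReach v (U ∪ I) A₁ A₂ F' G' N := by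
  obtain ⟨e, he⟩ := h
  refine ⟨e + t, fun m h0 hm => ?_⟩
  rw [add_right_comm]
  exact (he m h0 hm).trans h' hd

lemma BoxReach.expand {v : Fin n → Fin D → ℤ} {U I : Finset (Fin n)}
    {A₁ A₂ F G F' G' : Set (Fin n → Bool)} {N t : Fin D → ℤ} {d : Fin D} {x : ℤ}
    (h : BoxReach v U A₁ A₂ F G N) (h₀ : Reach v I F G F' G' t)
    (h₁ : Reach v I F G F' G' (t + Pi.single d x)) (hd : Disjoint U I)
    (hxN : x ≤ N d + 1) : BoxReach v (U ∪ I) A₁ A₂ F' G' (N + Pi.single d x) := by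
  obtain ⟨e, he⟩ := h
  refine ⟨e + t, fun m hm0 hm => ?_⟩
  by_cases hmd : m d ≤ N d
  · rw [add_right_comm]
    refine (he m hm0 fun l => ?_).trans h₀ hd
    by_cases hl : l = d
    · rwa [hl]
    · simpa [hl] using hm l
  · rw [show e + t + m = e + (m - Pi.single d x) + (t + Pi.single d x) by abel]
    refine (he _ (fun l => ?_) fun l => ?_).trans h₁ hd
    · by_cases hl : l = d
      · subst hl
        simp
        omega
      · simpa [hl] using hm0 l
    · simpa using hm l

/-- After expanding a box `t` times we have reached a box of size `N`, controlling the measures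
of the remaining families and the number of coordinates that were used. -/
def Progress (p r : Fin n → Bool → ℝ) (v : Fin n → Fin D → ℤ) (A₁ A₂ : Set (Fin n → Bool))
    (k : ℕ) (l₀ τ β : ℝ) (t : ℕ) (N : Fin D → ℤ) : Prop :=
  ∃ F G U l, BoxReach v U A₁ A₂ F G N ∧
    Real.exp (-l) ≤ smeas (prodMeas p) F * smeas (prodMeas r) G ∧
    l ≤ l₀ + t * β ∧ U.card * τ + k * l ≤ k * (l₀ + t * (τ + β))

lemma smeas_mul_smeas_le_one {κ : ℝ} (hκ : 0 < κ) {p r : Fin n → Bool → ℝ} (hp : IsWeight κ p)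
    (hr : IsWeight κ r) (F G : Set (Fin n → Bool)) :
    smeas (prodMeas p) F * smeas (prodMeas r) G ≤ 1 := by
  have h1 := smeas_le_sum (prodMeas_nonneg (hp.nonneg hκ)) F
  have h2 := smeas_le_sum (prodMeas_nonneg (hr.nonneg hκ)) G
  rw [sum_prodMeas hp.sum_eq] at h1
  rw [sum_prodMeas hr.sum_eq] at h2
  exact mul_le_one₀ h1 (smeas_nonneg (prodMeas_nonneg (hr.nonneg hκ)) G) h2

lemma Progress.step {κ γ τ l₀ : ℝ} (hκ : 0 < κ) (hτ : 0 < τ) {k : ℕ}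
    {p r : Fin n → Bool → ℝ} (hp : IsWeight κ p) (hr : IsWeight κ r)
    {v : Fin n → Fin D → ℤ} {R : Fin D → ℤ} (hv : Generating γ R k v)
    (hR : ∀ d, 0 < R d)
    (hτκ : (20 / κ + 1) ^ k * τ ≤ κ / 20) {A₁ A₂ : Set (Fin n → Bool)} {β : ℝ}
    (hβ : ((20 / κ + 1) ^ k - 1) * τ = β) {t : ℕ} {N : Fin D → ℤ}
    (h : Progress p r v A₁ A₂ k l₀ τ β t N)
    (hbudget : k * (l₀ + t * (τ + β)) ≤ γ * n * τ) {d : Fin D} {x : ℤ} (hx : 0 ≤ x)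
    (hxN : x ≤ N d + 1) (hxR : x ≤ R d) :
    Progress p r v A₁ A₂ k l₀ τ β (t + 1) (N + Pi.single d x) := by
  have hK : 1 ≤ 20 / κ + 1 := by linarith [show 0 ≤ 20 / κ by positivity]
  have nonneg_of : ∀ {F G : Set (Fin n → Bool)} {l : ℝ},
      Real.exp (-l) ≤ smeas (prodMeas p) F * smeas (prodMeas r) G → 0 ≤ l := by
    intro F G l hl
    have := hl.trans (smeas_mul_smeas_le_one hκ hp hr F G)
    rw [Real.exp_le_one_iff] at this
    linarith
  have key : ∀ F G U l, BoxReach v U A₁ A₂ F G N →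
      Real.exp (-l) ≤ smeas (prodMeas p) F * smeas (prodMeas r) G →
      l ≤ l₀ + t * β → U.card * τ + k * l ≤ k * (l₀ + t * (τ + β)) →
      Progress p r v A₁ A₂ k l₀ τ β (t + 1) (N + Pi.single d x) ∨
      ∃ F' G' U', BoxReach v U' A₁ A₂ F' G' N ∧
        Real.exp (-(l - τ)) ≤ smeas (prodMeas p) F' * smeas (prodMeas r) G' ∧
        U'.card * τ + k * (l - τ) ≤ k * (l₀ + t * (τ + β)) := by
    intro F G U l hbox hl hl' hU
    have hk0 : (0 : ℝ) ≤ k * l := mul_nonneg k.cast_nonneg (nonneg_of hl)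
    have hUγ : (U.card : ℝ) ≤ γ * n := le_of_mul_le_mul_right (by linarith) hτ
    obtain ⟨S, S', hSS, hSU, hSU', hcard, hsum⟩ := hv (Pi.single d x) (fun j => by
      by_cases hj : j = d
      · subst hj
        simpa [abs_of_nonneg hx] using hxR
      · simpa [hj] using (hR j).le) U hUγ
    have hdisj : Disjoint U (S ∪ S') := (disjoint_union_left.2 ⟨hSU, hSU'⟩).symm
    have hI : (S ∪ S').card ≤ k := (card_union_le _ _).trans hcard
    have hpow : (20 / κ + 1) ^ (S ∪ S').card ≤ (20 / κ + 1) ^ k := pow_le_pow_right₀ hK hI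
    have hcardU : ∀ I' ⊆ S ∪ S', ((U ∪ I').card : ℝ) * τ ≤ U.card * τ + k * τ := by
      intro I' hI'
      rw [← add_mul]
      refine mul_le_mul_of_nonneg_right ?_ hτ.le
      exact_mod_cast (card_union_le _ _).trans
        (Nat.add_le_add_left ((card_le_card hI').trans hI) _)
    rcases reach_finset hκ hτ.le hp hr v F G (S ∪ S')
      ((mul_le_mul_of_nonneg_right hpow hτ.le).trans hτκ) with
      ⟨I', hI', F', G', s, hreach, hs⟩ | ⟨F', G', hreach, hs⟩
    · refine .inr ⟨F', G', U ∪ I', hbox.trans hreach (hdisj.mono_right hI'), ?_, ?_⟩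
      · rw [show -(l - τ) = τ + -l by ring, Real.exp_add]
        exact (mul_le_mul_of_nonneg_left hl (Real.exp_pos _).le).trans hs
      · linarith [hcardU I' hI']
    · refine .inl ⟨F', G', U ∪ (S ∪ S'), l + β,
        hbox.expand (hreach S' subset_union_right) ?_ hdisj hxN, ?_, ?_, ?_⟩
      · rw [hsum, add_sub_cancel]
        exact hreach S subset_union_left
      · rw [neg_add_rev, Real.exp_add]
        refine (mul_le_mul ?_ hl (Real.exp_pos _).le (Real.exp_pos _).le).trans hs
        rw [Real.exp_le_exp, neg_le_neg_iff, ← hβ]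
        exact mul_le_mul_of_nonneg_right (by linarith) hτ.le
      · push_cast
        linarith
      · push_cast
        linarith [hcardU _ subset_rfl]
  obtain ⟨F, G, U, l, hbox, hl, hl', hU⟩ := h
  obtain ⟨M, hM⟩ : ∃ M : ℕ, l ≤ M * τ := by
    obtain ⟨M, hM⟩ := exists_nat_ge (l / τ)
    exact ⟨M, (div_le_iff₀ hτ).1 hM⟩
  induction M generalizing F G U l with
  | zero =>
    refine (key F G U l hbox hl hl' hU).resolve_right ?_
    rintro ⟨F', G', U', -, h, -⟩
    have := nonneg_of h
    simp only [Nat.cast_zero, zero_mul] at hM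
    linarith
  | succ M ih =>
    refine (key F G U l hbox hl hl' hU).elim id ?_
    rintro ⟨F', G', U', h1, h2, h3⟩
    push_cast at hM
    exact ih F' G' U' _ h1 h2 (by linarith) h3 (by linarith)

/-- Growing a box one coordinate at a time, first doubling the side and then extending it by `R d`
in each step. -/
lemma exists_box_of_step {P : ℕ → (Fin D → ℤ) → Prop} {R : Fin D → ℤ} (hR : ∀ d, 0 < R d)
    {s L : ℕ} (hL : ∀ d, R d < 2 ^ L) (h0 : P 0 0)
    (hstep : ∀ t N d x, t < D * (s + L) → P t N → 0 ≤ x → x ≤ N d + 1 → x ≤ R d →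
      P (t + 1) (N + Pi.single d x)) :
    ∃ N, P (D * (s + L)) N ∧ ∀ d, s * R d ≤ N d := by
  have double : ∀ t N d, P t N → 0 ≤ N d → ∀ j : ℕ, t + j ≤ D * (s + L) →
      ∃ N', P (t + j) N' ∧ N ≤ N' ∧ min (2 ^ j - 1) (R d) ≤ N' d := by
    intro t N d hP hN j hj
    induction j with
    | zero => exact ⟨N, hP, le_rfl, (min_le_left _ _).trans (by simpa using hN)⟩
    | succ j ih =>
      obtain ⟨N', h1, h2, h3⟩ := ih (by omega)
      have hx : 0 ≤ min (R d) (N' d + 1) := le_min (hR d).le (by linarith [h2 d])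
      refine ⟨_, hstep (t + j) _ d _ (by omega) h1 hx (min_le_right _ _) (min_le_left _ _), ?_, ?_⟩
      · exact h2.trans (le_add_of_nonneg_right (Pi.single_nonneg.2 hx))
      · rw [pow_succ]
        simp
        have := hR d
        have : 0 ≤ N' d := hN.trans (h2 d)
        omega
  have extend : ∀ t N d, P t N → R d ≤ N d → ∀ j : ℕ, t + j ≤ D * (s + L) →
      ∃ N', P (t + j) N' ∧ N ≤ N' ∧ j * R d ≤ N' d := by
    intro t N d hP hN j hj
    induction j with
    | zero => exact ⟨N, hP, le_rfl, by simpa using (hR d).le.trans hN⟩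
    | succ j ih =>
      obtain ⟨N', h1, h2, h3⟩ := ih (by omega)
      refine ⟨_, hstep (t + j) _ d (R d) (by omega) h1 (hR d).le (by linarith [h2 d]) le_rfl, ?_, ?_⟩
      · exact h2.trans (le_add_of_nonneg_right (Pi.single_nonneg.2 (hR d).le))
      · simp
        linarith
  have key : ∀ E : Finset (Fin D), ∃ N, 0 ≤ N ∧ P (E.card * (L + s)) N ∧
      ∀ d ∈ E, s * R d ≤ N d := by
    intro E
    induction E using Finset.induction_on with
    | empty => exact ⟨0, le_rfl, by simpa using h0, by simp⟩
    | insert d E hd ih =>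
      obtain ⟨N, hN, hP, hE⟩ := ih
      have hcard : (E.card + 1) * (L + s) ≤ D * (s + L) := by
        rw [← card_insert_of_notMem hd, add_comm s]
        exact Nat.mul_le_mul_right _ (by simpa using card_le_univ (insert d E))
      obtain ⟨N₁, hP₁, hN₁, hd₁⟩ := double _ N d hP (hN d) L (by linarith)
      have hRN : R d ≤ N₁ d := (le_min (by linarith [hL d]) le_rfl).trans hd₁
      obtain ⟨N₂, hP₂, hN₂, hd₂⟩ := extend _ N₁ d hP₁ hRN s (by linarith)
      refine ⟨N₂, hN.trans (hN₁.trans hN₂), ?_, ?_⟩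
      · rw [card_insert_of_notMem hd, add_one_mul, ← add_assoc]
        exact hP₂
      · intro d' hd'
        rcases mem_insert.1 hd' with rfl | hd'
        · exact hd₂
        · exact (hE d' hd').trans ((hN₁.trans hN₂) d')
  obtain ⟨N, -, hP, hN⟩ := key univ
  rw [card_univ, Fintype.card_fin, add_comm L] at hP
  exact ⟨N, hP, fun d => hN d (mem_univ d)⟩

lemma exists_progress {κ γ τ l₀ : ℝ} (hκ : 0 < κ) (hτ : 0 < τ) {k : ℕ}
    {p r : Fin n → Bool → ℝ} (hp : IsWeight κ p) (hr : IsWeight κ r)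
    {v : Fin n → Fin D → ℤ} {R : Fin D → ℤ} (hv : Generating γ R k v)
    (hR : ∀ d, 0 < R d) (hτκ : (20 / κ + 1) ^ k * τ ≤ κ / 20) {A₁ A₂ : Set (Fin n → Bool)}
    {β : ℝ} (hβ : ((20 / κ + 1) ^ k - 1) * τ = β) {s L : ℕ} (hL : ∀ d, R d < 2 ^ L)
    (hl₀ : Real.exp (-l₀) ≤ smeas (prodMeas p) A₁ * smeas (prodMeas r) A₂)
    (hbudget : k * (l₀ + (D * (s + L) : ℕ) * (τ + β)) ≤ γ * n * τ) :
    ∃ N, Progress p r v A₁ A₂ k l₀ τ β (D * (s + L)) N ∧ ∀ d, s * R d ≤ N d := by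
  have hβ0 : 0 ≤ β := by
    rw [← hβ]
    exact mul_nonneg (sub_nonneg.2 (one_le_pow₀ (by linarith [show 0 ≤ 20 / κ by positivity])))
      hτ.le
  refine exists_box_of_step hR hL ?_ fun t N d x ht h hx hxN hxR =>
    h.step hκ hτ hp hr hv hR hτκ hβ (le_trans ?_ hbudget) hx hxN hxR
  · refine ⟨A₁, A₂, ∅, l₀, ⟨0, fun m h0 hm => ?_⟩, hl₀, by simp, by simp⟩
    rw [le_antisymm hm h0, add_zero]
    exact reach_refl v A₁ A₂
  · gcongr

end Box

/-! ### Reverse hypercontractivity -/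

section Hyper

lemma one_add_mul_add_sq_le_pow {t : ℝ} (ht : 0 ≤ t) (c : ℕ) :
    1 + c * t + c * (c - 1) / 2 * t ^ 2 ≤ (1 + t) ^ c := by
  induction c with
  | zero => simp
  | succ c ih =>
    rw [pow_succ]
    refine le_trans ?_ (mul_le_mul_of_nonneg_right ih (by linarith))
    push_cast
    have : 0 ≤ (c : ℝ) * (c - 1) / 2 := by
      rcases c with _ | c
      · simp
      · push_cast
        simp only [add_sub_cancel_right]
        positivity
    nlinarith [mul_nonneg this (pow_nonneg ht 3)]

lemma exists_mul_abs_le {κ : ℝ} (hκ : 0 < κ) {p u : Bool → ℝ} (hp : ∀ j, κ ≤ p j)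
    (hp1 : ∑ j, p j = 1) (hu : ∑ j, p j * u j = 0) : ∃ j, ∀ i, κ * |u i| ≤ u j := by
  simp only [Fintype.sum_bool] at hp1 hu
  have h1 := hp true
  have h2 := hp false
  rcases le_total 0 (u true) with h | h
  · refine ⟨true, fun i => ?_⟩
    cases i
    · have : u false ≤ 0 := by nlinarith
      rw [abs_of_nonpos this]
      nlinarith
    · rw [abs_of_nonneg h]
      nlinarith
  · refine ⟨false, fun i => ?_⟩
    have hf : 0 ≤ u false := by nlinarith
    cases i
    · rw [abs_of_nonneg hf]
      nlinarith
    · rw [abs_of_nonpos h]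
      nlinarith

lemma one_le_sum_two_point {κ : ℝ} (hκ : 0 < κ) {c : ℕ} (hc : 1 ≤ 2 * κ ^ 3 * (c - 1))
    {q : Bool × Bool → ℝ} (hq : ∀ j, κ ≤ q j) (hq1 : ∑ j, q j = 1) {u v : Bool → ℝ}
    (hu : ∑ j, q j * u j.1 = 0) (hv : ∑ j, q j * v j.2 = 0) (hu1 : ∀ j, -1 ≤ u j)
    (hv1 : ∀ j, -1 ≤ v j) : 1 ≤ ∑ j, q j * ((1 + u j.1) * (1 + v j.2)) ^ c := by
  have hc1 : 0 < (c : ℝ) - 1 := by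
    by_contra! h
    nlinarith [pow_pos hκ 3]
  obtain ⟨j₁, h₁⟩ := exists_mul_abs_le hκ (p := fun j => ∑ j', q (j, j')) (u := u)
    (fun j => by simp only [Fintype.sum_bool]; linarith [hq (j, true), hq (j, false)])
    (by rw [← hq1, Fintype.sum_prod_type])
    (by rw [← hu, Fintype.sum_prod_type]; simp only [sum_mul])
  obtain ⟨j₂, h₂⟩ := exists_mul_abs_le hκ (p := fun j => ∑ j', q (j', j)) (u := v)
    (fun j => by simp only [Fintype.sum_bool]; linarith [hq (true, j), hq (false, j)])
    (by rw [← hq1, Fintype.sum_prod_type_right])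
    (by rw [← hv, Fintype.sum_prod_type_right]; simp only [sum_mul])
  have hu0 : 0 ≤ u j₁ := (mul_nonneg hκ.le (abs_nonneg _)).trans (h₁ j₁)
  have hv0 : 0 ≤ v j₂ := (mul_nonneg hκ.le (abs_nonneg _)).trans (h₂ j₂)
  have hbern : ∀ j, 1 + c * (u j.1 + v j.2 + u j.1 * v j.2) +
      (if j = (j₁, j₂) then 2 * c * (c - 1) * (u j₁ * v j₂) else 0) ≤
      ((1 + u j.1) * (1 + v j.2)) ^ c := by
    intro j
    rw [show (1 + u j.1) * (1 + v j.2) = 1 + (u j.1 + v j.2 + u j.1 * v j.2) by ring]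
    split_ifs with h
    · subst h
      refine le_trans ?_ (one_add_mul_add_sq_le_pow (by positivity) c)
      have h4 : 4 * (u j₁ * v j₂) ≤ (u j₁ + v j₂ + u j₁ * v j₂) ^ 2 := by
        nlinarith [sq_nonneg (u j₁ - v j₂), mul_nonneg hu0 hv0]
      have := mul_le_mul_of_nonneg_left h4
        (show 0 ≤ (c : ℝ) * (c - 1) / 2 by positivity)
      simp only
      linarith
    · rw [add_zero]
      refine one_add_mul_le_pow ?_ c
      nlinarith [hu1 j.1, hv1 j.2, mul_nonneg (neg_le_iff_add_nonneg'.1 (hu1 j.1))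
        (neg_le_iff_add_nonneg'.1 (hv1 j.2))]
  have hcov : -(u j₁ * v j₂) ≤ κ ^ 2 * ∑ j, q j * (u j.1 * v j.2) := by
    rw [mul_sum, ← mul_one (-(u j₁ * v j₂)), ← hq1, mul_sum]
    refine sum_le_sum fun j _ => ?_
    have h3 := mul_le_mul (h₁ j.1) (h₂ j.2) (by positivity) hu0
    have h4 := neg_abs_le (u j.1 * v j.2)
    rw [abs_mul] at h4
    nlinarith [mul_le_mul_of_nonneg_left h4 (sq_nonneg κ), hκ.trans_le (hq j),
      mul_nonneg (hκ.le.trans (hq j)) (show 0 ≤ κ ^ 2 * (u j.1 * v j.2) + u j₁ * v j₂ by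
        nlinarith [mul_le_mul_of_nonneg_left h4 (sq_nonneg κ)])]
  refine le_trans ?_ (sum_le_sum fun j _ =>
    mul_le_mul_of_nonneg_left (hbern j) (hκ.le.trans (hq j)))
  have hsplit : ∀ j, q j * (1 + c * (u j.1 + v j.2 + u j.1 * v j.2) +
      (if j = (j₁, j₂) then 2 * c * (c - 1) * (u j₁ * v j₂) else 0)) =
      q j + c * (q j * u j.1) + c * (q j * v j.2) + c * (q j * (u j.1 * v j.2)) +
      if j = (j₁, j₂) then q j * (2 * c * (c - 1) * (u j₁ * v j₂)) else 0 := by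
    intro j
    split_ifs <;> ring
  simp only [hsplit, sum_add_distrib, ← mul_sum, hu, hv, hq1, sum_ite_eq', mem_univ, if_true,
    mul_zero, add_zero]
  set E := ∑ j, q j * (u j.1 * v j.2)
  have h5 : κ * (2 * c * (c - 1) * (u j₁ * v j₂)) ≤ q (j₁, j₂) * (2 * c * (c - 1) * (u j₁ * v j₂)) :=
    mul_le_mul_of_nonneg_right (hq _) (by positivity)
  have h6 : 0 ≤ E + 2 * κ * (c - 1) * (u j₁ * v j₂) := by
    refine nonneg_of_mul_nonneg_right (a := κ ^ 2) ?_ (by positivity)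
    nlinarith [mul_le_mul_of_nonneg_right hc (mul_nonneg hu0 hv0)]
  nlinarith [mul_nonneg c.cast_nonneg h6 (α := ℝ)]

lemma two_point {κ : ℝ} (hκ : 0 < κ) {c : ℕ} (hc : 1 ≤ 2 * κ ^ 3 * (c - 1))
    {q : Bool × Bool → ℝ} (hq : ∀ j, κ ≤ q j) (hq1 : ∑ j, q j = 1) {x y : Bool → ℝ}
    (hx : ∀ j, 0 ≤ x j) (hy : ∀ j, 0 ≤ y j) :
    ((∑ j, q j * x j.1) * ∑ j, q j * y j.2) ^ c ≤ ∑ j, q j * (x j.1 * y j.2) ^ c := by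
  have hq0 : ∀ j, 0 ≤ q j := fun j => hκ.le.trans (hq j)
  have hc0 : c ≠ 0 := by
    rintro rfl
    nlinarith [pow_pos hκ 3, Nat.cast_zero (R := ℝ)]
  set X := ∑ j, q j * x j.1 with hX
  set Y := ∑ j, q j * y j.2 with hY
  have hX0 : 0 ≤ X := sum_nonneg fun j _ => mul_nonneg (hq0 j) (hx _)
  have hY0 : 0 ≤ Y := sum_nonneg fun j _ => mul_nonneg (hq0 j) (hy _)
  rcases (mul_nonneg hX0 hY0).eq_or_lt with h0 | h0
  · rw [← h0, zero_pow hc0]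
    exact sum_nonneg fun j _ => mul_nonneg (hq0 j) (pow_nonneg (mul_nonneg (hx _) (hy _)) c)
  have hXp : 0 < X := pos_of_mul_pos_left h0 hY0
  have hYp : 0 < Y := pos_of_mul_pos_right h0 hX0
  have key := one_le_sum_two_point hκ hc hq hq1 (u := fun j => x j / X - 1)
    (v := fun j => y j / Y - 1)
    (by simp only [mul_sub, mul_one, sum_sub_distrib, hq1, ← mul_div_assoc, ← sum_div, ← hX]
        rw [div_self hXp.ne', sub_self])
    (by simp only [mul_sub, mul_one, sum_sub_distrib, hq1, ← mul_div_assoc, ← sum_div, ← hY]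
        rw [div_self hYp.ne', sub_self])
    (fun j => by linarith [div_nonneg (hx j) hX0]) (fun j => by linarith [div_nonneg (hy j) hY0])
  refine (le_mul_of_one_le_right (pow_pos h0 c).le key).trans_eq ?_
  rw [mul_sum]
  refine sum_congr rfl fun j _ => ?_
  rw [mul_left_comm, ← mul_pow]
  congr 2
  field_simp
  ring

lemma sum_prodMeas_cons {n : ℕ} {J : Type*} [Fintype J] (p : Fin (n + 1) → J → ℝ)
    (f : (Fin (n + 1) → J) → ℝ) :
    ∑ a, prodMeas p a * f a =
      ∑ j, p 0 j * ∑ a, prodMeas (fun i => p i.succ) a * f (Fin.cons j a) := by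
  rw [← (Fin.consEquiv fun _ => J).sum_comp, Fintype.sum_prod_type]
  simp [Fin.consEquiv, prodMeas, Fin.prod_univ_succ, mul_sum, mul_assoc]

/-- A form of reverse hypercontractivity for correlated product spaces. -/
lemma mul_pow_le_sum_prodMeas {n : ℕ} {κ : ℝ} (hκ : 0 < κ) {c : ℕ}
    (hc : 1 ≤ 2 * κ ^ 3 * (c - 1)) {q : Fin n → Bool × Bool → ℝ} (hq : IsWeight κ q)
    {p₁ p₂ : Fin n → Bool → ℝ} (hp₁ : ∀ i j, ∑ j' : Bool, q i (j, j') = p₁ i j)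
    (hp₂ : ∀ i j, ∑ j' : Bool, q i (j', j) = p₂ i j) {f g : (Fin n → Bool) → ℝ}
    (hf : ∀ a, 0 ≤ f a) (hg : ∀ b, 0 ≤ g b) :
    ((∑ a, prodMeas p₁ a * f a) * ∑ b, prodMeas p₂ b * g b) ^ c ≤
      ∑ r, prodMeas q r * (f (fun i => (r i).1) * g (fun i => (r i).2)) ^ c := by
  induction n with
  | zero =>
    simp only [prodMeas, Finset.univ_unique, sum_singleton, Finset.univ_eq_empty, prod_empty,
      one_mul]
    exact le_of_eq (congrArg₂ (fun a b => (f a * g b) ^ c) (Subsingleton.elim _ _)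
      (Subsingleton.elim _ _))
  | succ n ih =>
    simp only [sum_prodMeas_cons]
    set x : Bool → ℝ := fun j => ∑ a, prodMeas (fun i => p₁ i.succ) a * f (Fin.cons j a) with hx
    set y : Bool → ℝ := fun j => ∑ b, prodMeas (fun i => p₂ i.succ) b * g (Fin.cons j b) with hy
    have hp₁0 : ∀ i j, 0 ≤ p₁ i j := fun i j => by
      rw [← hp₁]
      exact sum_nonneg fun _ _ => hq.nonneg hκ _ _
    have hp₂0 : ∀ i j, 0 ≤ p₂ i j := fun i j => by
      rw [← hp₂]
      exact sum_nonneg fun _ _ => hq.nonneg hκ _ _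
    have h := two_point hκ hc (hq.le 0) (hq.sum_eq 0) (x := x) (y := y)
      (fun j => sum_nonneg fun a _ => mul_nonneg (prodMeas_nonneg (fun i => hp₁0 i.succ) a) (hf _))
      (fun j => sum_nonneg fun a _ => mul_nonneg (prodMeas_nonneg (fun i => hp₂0 i.succ) a) (hg _))
    have hX : ∑ j, q 0 j * x j.1 = ∑ j, p₁ 0 j * x j := by
      rw [Fintype.sum_prod_type]
      simp only [← hp₁, sum_mul]
    have hY : ∑ j, q 0 j * y j.2 = ∑ j, p₂ 0 j * y j := by
      rw [Fintype.sum_prod_type_right]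
      simp only [← hp₂, sum_mul]
    rw [hX, hY] at h
    refine h.trans (sum_le_sum fun j _ => mul_le_mul_of_nonneg_left ?_ (hq.nonneg hκ _ _))
    refine (ih (q := fun i => q i.succ) ⟨fun i => hq.sum_eq _, fun i => hq.le _⟩
      (fun i => hp₁ i.succ) (fun i => hp₂ i.succ) (fun a => hf (Fin.cons j.1 a))
      (fun b => hg (Fin.cons j.2 b))).trans_eq (sum_congr rfl fun r _ => ?_)
    congr 4 <;>
    · funext i
      cases i using Fin.cases <;> simp

end Hyper

/-! ### Concentration -/

section Concentration

variable {n : ℕ}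

lemma sum_prodMeas_mul_exp_le {J : Type*} [Fintype J] [DecidableEq J] {p y : Fin n → J → ℝ}
    (hp : ∀ i j, 0 ≤ p i j) (hp1 : ∀ i, ∑ j, p i j = 1) (hy : ∀ i j, |y i j| ≤ 1)
    (hy0 : ∀ i, ∑ j, p i j * y i j = 0) {x : ℝ} (hx0 : 0 ≤ x) (hx1 : x ≤ 1) :
    ∑ a, prodMeas p a * Real.exp (x * ∑ i, y i (a i)) ≤ Real.exp (n * x ^ 2) := by
  have h1 : ∀ a : Fin n → J, prodMeas p a * Real.exp (x * ∑ i, y i (a i)) =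
      ∏ i, p i (a i) * Real.exp (x * y i (a i)) := fun a => by
    rw [prod_mul_distrib, mul_sum, Real.exp_sum]
    rfl
  have h2 : ∀ i, ∑ j, p i j * Real.exp (x * y i j) ≤ Real.exp (x ^ 2) := fun i => by
    have : ∀ j, p i j * Real.exp (x * y i j) ≤ p i j * (1 + x ^ 2) + x * (p i j * y i j) := by
      intro j
      have habs : |x * y i j| ≤ x := by
        rw [abs_mul, abs_of_nonneg hx0]
        exact mul_le_of_le_one_right hx0 (hy i j)
      have h := (le_abs_self _).trans (Real.abs_exp_sub_one_sub_id_le (habs.trans hx1))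
      have hsq : (x * y i j) ^ 2 ≤ x ^ 2 := by
        rw [← sq_abs (x * y i j)]
        gcongr
      nlinarith [mul_le_mul_of_nonneg_left (show Real.exp (x * y i j) ≤ 1 + x ^ 2 + x * y i j by
        linarith) (hp i j)]
    refine (sum_le_sum fun j _ => this j).trans ?_
    rw [sum_add_distrib, ← sum_mul, ← mul_sum, hy0, hp1]
    linarith [Real.add_one_le_exp (x ^ 2)]
  simp only [h1, sum_prod_pi fun i j => p i j * Real.exp (x * y i j)]
  refine (prod_le_prod (fun i _ => sum_nonneg fun j _ =>
    mul_nonneg (hp i j) (Real.exp_pos _).le) fun i _ => h2 i).trans_eq ?_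
  rw [prod_const, card_univ, Fintype.card_fin, ← Real.exp_nat_mul]

lemma smeas_sum_gt_le {J : Type*} [Fintype J] [DecidableEq J] {p y : Fin n → J → ℝ}
    (hp : ∀ i j, 0 ≤ p i j) (hp1 : ∀ i, ∑ j, p i j = 1) (hy : ∀ i j, |y i j| ≤ 1)
    (hy0 : ∀ i, ∑ j, p i j * y i j = 0) {σ : ℝ} (hσ0 : 0 ≤ σ) (hσ1 : σ ≤ 1) :
    smeas (prodMeas p) {a | σ * n / 2 < ∑ i, y i (a i)} ≤ Real.exp (-(n * σ ^ 2 / 16)) := by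
  have h := sum_prodMeas_mul_exp_le hp hp1 hy hy0 (x := σ / 4) (by positivity) (by linarith)
  have h' : smeas (prodMeas p) {a | σ * n / 2 < ∑ i, y i (a i)} * Real.exp (n * σ ^ 2 / 8) ≤
      ∑ a, prodMeas p a * Real.exp (σ / 4 * ∑ i, y i (a i)) := by
    rw [smeas, sum_mul]
    refine sum_le_sum fun a _ => ?_
    have ha := prodMeas_nonneg hp a
    by_cases hmem : σ * n / 2 < ∑ i, y i (a i)
    · rw [Set.indicator_of_mem (by exact hmem)]
      refine mul_le_mul_of_nonneg_left (Real.exp_le_exp.2 ?_) ha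
      nlinarith
    · rw [Set.indicator_of_notMem (by exact hmem), zero_mul]
      positivity
  rw [← le_div_iff₀ (Real.exp_pos _)] at h'
  refine h'.trans ((div_le_div_of_nonneg_right h (Real.exp_pos _).le).trans ?_)
  rw [← Real.exp_sub, Real.exp_le_exp]
  linarith

lemma smeas_abs_sum_gt_le {J : Type*} [Fintype J] [DecidableEq J] {p y : Fin n → J → ℝ}
    (hp : ∀ i j, 0 ≤ p i j) (hp1 : ∀ i, ∑ j, p i j = 1) (hy : ∀ i j, |y i j| ≤ 1)
    (hy0 : ∀ i, ∑ j, p i j * y i j = 0) {σ : ℝ} (hσ0 : 0 ≤ σ) (hσ1 : σ ≤ 1) :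
    smeas (prodMeas p) {a | σ * n / 2 < |∑ i, y i (a i)|} ≤
      2 * Real.exp (-(n * σ ^ 2 / 16)) := by
  have h1 := smeas_sum_gt_le hp hp1 hy hy0 hσ0 hσ1
  have h2 := smeas_sum_gt_le hp hp1 (y := fun i j => -y i j) (by simpa using hy)
    (by simpa using hy0) hσ0 hσ1
  rw [two_mul]
  refine (smeas_mono (prodMeas_nonneg hp) ?_).trans
    ((smeas_union_le (prodMeas_nonneg hp) _ _).trans (add_le_add h1 h2))
  intro a ha
  simpa [lt_abs] using ha

lemma smeas_iUnion_le {α ι : Type*} [Fintype α] [Fintype ι] {μ : α → ℝ} (hμ : ∀ a, 0 ≤ μ a)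
    (A : ι → Set α) : smeas μ (⋃ i, A i) ≤ ∑ i, smeas μ (A i) := by
  simp only [smeas]
  rw [sum_comm]
  refine sum_le_sum fun a _ => ?_
  have h0 : ∀ i, 0 ≤ (A i).indicator μ a := fun i => Set.indicator_nonneg (fun _ _ => hμ _) a
  by_cases h : a ∈ ⋃ i, A i
  · obtain ⟨i, hi⟩ := Set.mem_iUnion.1 h
    rw [Set.indicator_of_mem h, ← Set.indicator_of_mem hi μ]
    exact single_le_sum (fun i _ => h0 i) (mem_univ i)
  · rw [Set.indicator_of_notMem h]
    exact sum_nonneg fun i _ => h0 i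

/-- The intersection vector is concentrated around its mean. -/
lemma smeas_exists_abs_sub_gt_le {D : ℕ} {q : Fin n → Bool × Bool → ℝ}
    (hq : ∀ i j, 0 ≤ q i j) (hq1 : ∀ i, ∑ j, q i j = 1) {v : Fin n → Fin D → ℤ}
    {R : Fin D → ℤ} (hR : ∀ d, 0 < R d) (hv : ∀ i d, |v i d| ≤ R d) {σ : ℝ} (hσ0 : 0 ≤ σ)
    (hσ1 : σ ≤ 1) (I : Finset (Fin n)) :
    smeas (prodMeas q) {r | ∃ d, σ * n / 2 * R d <
      |((∑ i ∈ I, capArr v i (r i) d : ℤ) : ℝ) - ∑ i ∈ I, q i (true, true) * v i d|} ≤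
      D * (2 * Real.exp (-(n * σ ^ 2 / 16))) := by
  have hRpos : ∀ d, (0 : ℝ) < R d := fun d => by exact_mod_cast hR d
  have hq_le : ∀ i j, q i j ≤ 1 := fun i j => by
    rw [← hq1 i]
    exact single_le_sum (fun j _ => hq i j) (mem_univ j)
  set y : Fin D → Fin n → Bool × Bool → ℝ := fun d i j =>
    if i ∈ I then ((if j = (true, true) then 1 else 0) - q i (true, true)) * (v i d / R d) else 0
    with hy
  have hy1 : ∀ d i j, |y d i j| ≤ 1 := by
    intro d i j
    simp only [hy]
    split_ifs with h1 h2
    · rw [abs_mul]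
      refine mul_le_one₀ ?_ (abs_nonneg _) ?_
      · rw [abs_of_nonneg] <;> linarith [hq_le i (true, true), hq i (true, true)]
      · rw [abs_div, abs_of_pos (hRpos d), div_le_one (hRpos d)]
        exact_mod_cast hv i d
    · rw [abs_mul]
      refine mul_le_one₀ ?_ (abs_nonneg _) ?_
      · rw [zero_sub, abs_neg, abs_of_nonneg] <;>
          linarith [hq_le i (true, true), hq i (true, true)]
      · rw [abs_div, abs_of_pos (hRpos d), div_le_one (hRpos d)]
        exact_mod_cast hv i d
    · simp
  have hy0 : ∀ d i, ∑ j, q i j * y d i j = 0 := by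
    intro d i
    simp only [hy]
    split_ifs with h1
    · simp only [← mul_assoc, ← sum_mul, mul_sub, sum_sub_distrib, hq1, mul_ite, mul_one, mul_zero,
        sum_ite_eq', mem_univ, if_true, one_mul, sub_self, zero_mul]
    · simp
  have hsub : {r : Fin n → Bool × Bool | ∃ d, σ * n / 2 * R d <
      |((∑ i ∈ I, capArr v i (r i) d : ℤ) : ℝ) - ∑ i ∈ I, q i (true, true) * v i d|} ⊆
      ⋃ d, {r | σ * n / 2 < |∑ i, y d i (r i)|} := by
    rintro r ⟨d, hd⟩
    refine Set.mem_iUnion.2 ⟨d, ?_⟩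
    have : ((∑ i ∈ I, capArr v i (r i) d : ℤ) : ℝ) - ∑ i ∈ I, q i (true, true) * v i d =
        (∑ i, y d i (r i)) * R d := by
      simp only [hy, ← sum_filter, filter_mem_eq_inter, univ_inter]
      rw [Int.cast_sum, ← sum_sub_distrib, sum_mul]
      refine sum_congr rfl fun i _ => ?_
      rw [mul_assoc, div_mul_cancel₀ _ (hRpos d).ne', sub_mul]
      congr 1
      simp only [capArr, Prod.ext_iff]
      split_ifs <;> simp
    rw [this, abs_mul, abs_of_pos (hRpos d)] at hd
    exact lt_of_mul_lt_mul_right hd (hRpos d).le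
  refine (smeas_mono (prodMeas_nonneg hq) hsub).trans ((smeas_iUnion_le (prodMeas_nonneg hq)
    _).trans ((sum_le_sum fun d _ => smeas_abs_sum_gt_le hq hq1 (hy1 d) (hy0 d) hσ0 hσ1).trans ?_))
  simp

end Concentration

/-! ### Tilting the measure -/

section Tilt

variable {n D : ℕ}

lemma Generating.exists_combination {γ : ℝ} {R : Fin D → ℤ} {k : ℕ} {v : Fin n → Fin D → ℤ}
    (hv : Generating γ R k v) (hR : ∀ d, 0 < R d) (U : Finset (Fin n)) (d : Fin D) {J : ℕ}
    (hJ : (U.card : ℝ) + J * k ≤ γ * n) :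
    ∃ χ : Fin n → ℤ, (∀ i, |χ i| ≤ 1) ∧ (∀ i ∈ U, χ i = 0) ∧
      ∑ i, χ i • v i = (J : ℤ) • Pi.single d (R d) := by
  suffices ∃ χ : Fin n → ℤ, ∃ T, U ⊆ T ∧ T.card ≤ U.card + J * k ∧ (∀ i ∉ T, χ i = 0) ∧
      (∀ i, |χ i| ≤ 1) ∧ (∀ i ∈ U, χ i = 0) ∧ ∑ i, χ i • v i = (J : ℤ) • Pi.single d (R d) by
    obtain ⟨χ, T, -, -, -, h⟩ := this
    exact ⟨χ, h⟩
  induction J with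
  | zero => exact ⟨0, U, subset_rfl, by simp, by simp, by simp, by simp, by simp⟩
  | succ J ih =>
    push_cast at hJ
    have hk : (0 : ℝ) ≤ k := k.cast_nonneg
    obtain ⟨χ, T, hUT, hT, hχT, hχ, hχU, hsum⟩ := ih (by linarith)
    have hT' : (T.card : ℝ) ≤ U.card + J * k := by exact_mod_cast hT
    obtain ⟨S, S', hSS, hST, hST', hcard, hS⟩ := hv (Pi.single d (R d)) (fun j => by
      by_cases hj : j = d
      · subst hj
        simp [abs_of_pos (hR j)]
      · simpa [hj] using (hR j).le) T (by linarith)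
    refine ⟨fun i => χ i + ((if i ∈ S then 1 else 0) - if i ∈ S' then 1 else 0), T ∪ (S ∪ S'),
      hUT.trans subset_union_left, ?_, fun i hi => ?_, fun i => ?_, fun i hi => ?_, ?_⟩
    · refine (card_union_le _ _).trans ?_
      have := (card_union_le S S').trans hcard
      rw [add_one_mul]
      omega
    · simp only [mem_union, not_or] at hi
      simp [hi, hχT i hi.1]
    · by_cases hi : i ∈ T
      · have h1 : i ∉ S := fun h => disjoint_left.1 hST h hi
        have h2 : i ∉ S' := fun h => disjoint_left.1 hST' h hi
        simpa [h1, h2] using hχ i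
      · simp only [hχT i hi]
        split_ifs <;> simp
    · have h1 : i ∉ S := fun h => disjoint_left.1 hST h (hUT hi)
      have h2 : i ∉ S' := fun h => disjoint_left.1 hST' h (hUT hi)
      simp [h1, h2, hχU i hi]
    · simp only [add_smul, sub_smul, sum_add_distrib, sum_sub_distrib, ite_smul, one_smul,
        zero_smul, sum_ite_mem, univ_inter, hsum, ← hS]
      push_cast
      rw [add_smul, one_smul]

lemma Generating.exists_tilt {γ : ℝ} {R : Fin D → ℤ} {k : ℕ} {v : Fin n → Fin D → ℤ}
    (hv : Generating γ R k v) (hR : ∀ d, 0 < R d) (U : Finset (Fin n)) {J : ℕ} (hJ0 : 0 < J)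
    (hJ : (U.card : ℝ) + J * k ≤ γ * n) {ρ : ℝ} {Δ : Fin D → ℝ}
    (hΔ : ∀ d, |Δ d| ≤ ρ * J * R d) :
    ∃ t : Fin n → ℝ, (∀ i, |t i| ≤ D * ρ) ∧ (∀ i ∈ U, t i = 0) ∧
      ∀ d, ∑ i, t i * v i d = Δ d := by
  choose χ h1 h2 h3 using fun d => hv.exists_combination hR U d hJ
  have hRJ : ∀ d, (0 : ℝ) < J * R d := fun d =>
    mul_pos (by exact_mod_cast hJ0) (by exact_mod_cast hR d)
  refine ⟨fun i => ∑ d, Δ d / (J * R d) * χ d i, fun i => ?_, fun i hi => ?_, fun d => ?_⟩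
  · refine (abs_sum_le_sum_abs _ _).trans ((sum_le_card_nsmul univ _ ρ fun d _ => ?_).trans_eq ?_)
    · rw [abs_mul, ← mul_one ρ]
      have hχ : |(χ d i : ℝ)| ≤ 1 := by exact_mod_cast h1 d i
      have hρ : |Δ d / (J * R d)| ≤ ρ := by
        rw [abs_div, abs_of_pos (hRJ d), div_le_iff₀ (hRJ d), ← mul_assoc]
        exact hΔ d
      exact mul_le_mul hρ hχ (abs_nonneg _) ((abs_nonneg _).trans hρ)
    · simp
  · exact sum_eq_zero fun d _ => by simp [h2 d i hi]
  · have h4 : ∀ d', ∑ i, (χ d' i : ℝ) * v i d = J * (Pi.single d' (R d') : Fin D → ℤ) d := by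
      intro d'
      have := congrFun (h3 d') d
      simp only [Finset.sum_apply, Pi.smul_apply, smul_eq_mul] at this
      exact_mod_cast this
    simp only [sum_mul]
    rw [sum_comm]
    simp only [mul_assoc, ← mul_sum, h4]
    rw [sum_eq_single d]
    · rw [Pi.single_eq_same, div_mul_cancel₀ _ (hRJ d).ne']
    · intro d' _ hd'
      simp [Pi.single_eq_of_ne' hd']
    · simp

lemma arrExp_capArr {q : Fin n → Bool × Bool → ℝ} (hq : ∀ i, ∑ j, q i j = 1)
    (v : Fin n → Fin D → ℤ) (d : Fin D) :
    arrExp (capArr v) (prodMeas q) d = ∑ i, q i (true, true) * v i d := by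
  simp only [arrExp, arrEval, Int.cast_sum, mul_sum]
  rw [sum_comm]
  refine sum_congr rfl fun i _ => ?_
  have := sum_update i (hq i) fun r => (capArr v i (r i) d : ℝ)
  simp only [Function.update_self, ← sum_mul, sum_prodMeas hq, one_mul] at this
  rw [← this, Fintype.sum_eq_single (true, true)]
  · simp [capArr]
  · intro j hj
    have : ¬ (j.1 = true ∧ j.2 = true) := by simpa [Prod.ext_iff] using hj
    simp [capArr, this]

lemma sum_capArr_eq_capOn (v : Fin n → Fin D → ℤ) (I : Finset (Fin n)) (a b : Fin n → Bool)
    (d : Fin D) : ∑ i ∈ I, capArr v i (a i, b i) d = capOn v I a b d := by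
  simp only [capOn, capArr, Finset.sum_apply]
  exact sum_congr rfl fun i _ => by split_ifs <;> rfl

lemma abs_capOn_le {v : Fin n → Fin D → ℤ} {R : Fin D → ℤ} (hv : ∀ i d, |v i d| ≤ R d)
    (I : Finset (Fin n)) (a b : Fin n → Bool) (d : Fin D) : |capOn v I a b d| ≤ I.card * R d := by
  rw [← sum_capArr_eq_capOn, ← nsmul_eq_mul]
  refine (abs_sum_le_sum_abs _ _).trans (sum_le_card_nsmul _ _ _ fun i _ => ?_)
  simp only [capArr]
  split_ifs
  · exact hv i d
  · simpa using (abs_nonneg _).trans (hv i d)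

lemma exists_tilted_weight {γ : ℝ} {R : Fin D → ℤ} {k : ℕ} {v : Fin n → Fin D → ℤ}
    (hv : Generating γ R k v) (hR : ∀ d, 0 < R d) (U : Finset (Fin n)) {J : ℕ} (hJ0 : 0 < J)
    (hJ : (U.card : ℝ) + J * k ≤ γ * n) {ρ : ℝ} {Δ : Fin D → ℝ}
    (hΔ : ∀ d, |Δ d| ≤ ρ * J * R d) {κ η : ℝ} (hη0 : 0 ≤ η) (hη1 : η ≤ 1) (hκ : 0 < κ)
    (hρ : D * ρ ≤ κ * η / 2) {q : Fin n → Bool × Bool → ℝ} (hq : IsWeight κ q) :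
    ∃ q' : Fin n → Bool × Bool → ℝ, IsWeight (κ / 2) q' ∧
      (∀ i j, ∑ j', q' i (j, j') = ∑ j', q i (j, j')) ∧
      (∀ i j, ∑ j', q' i (j', j) = ∑ j', q i (j', j)) ∧
      (∀ i j, (1 - η) * q' i j ≤ q i j) ∧
      ∀ d, ∑ i ∈ Uᶜ, q' i (true, true) * v i d = ∑ i ∈ Uᶜ, q i (true, true) * v i d + Δ d := by
  obtain ⟨t, ht, htU, htΔ⟩ := hv.exists_tilt hR U hJ0 hJ hΔ
  have ht' : ∀ i, |t i| ≤ κ * η / 2 := fun i => (ht i).trans hρ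
  have hs : ∀ i j, |(q i j + if j.1 = j.2 then t i else -t i) - q i j| ≤ κ * η / 2 := by
    intro i j
    rw [add_sub_cancel_left]
    split_ifs
    · exact ht' i
    · rw [abs_neg]
      exact ht' i
  refine ⟨fun i j => q i j + if j.1 = j.2 then t i else -t i, ⟨fun i => ?_, fun i j => ?_⟩,
    fun i j => ?_, fun i j => ?_, fun i j => ?_, fun d => ?_⟩
  · rw [sum_add_distrib, hq.sum_eq]
    simp [Fintype.sum_prod_type]
  · have := abs_le.1 (hs i j)
    nlinarith [hq.le i j]
  · cases j <;> simp <;> ring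
  · cases j <;> simp <;> ring
  · have := abs_le.1 (hs i j)
    nlinarith [hq.le i j]
  · simp only [if_true, add_mul, sum_add_distrib]
    rw [← htΔ d, ← sum_compl_add_sum U fun i => t i * (v i d : ℝ),
      sum_eq_zero (s := U) fun i hi => by rw [htU i hi, zero_mul], add_zero]

/-- A lower bound for the measure of the intersections equal to `w`, given that a box is reached. -/
lemma BoxReach.le_smeas {κ γ η σ ζ : ℝ} (hκ : 0 < κ) {R : Fin D → ℤ} (hR : ∀ d, 0 < R d)
    {k : ℕ} {v : Fin n → Fin D → ℤ} (hvR : ∀ i d, |v i d| ≤ R d) (hv : Generating γ R k v)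
    {q : Fin n → Bool × Bool → ℝ} (hq : IsWeight κ q) {p₁ p₂ : Fin n → Bool → ℝ}
    (hp₁ : ∀ i j, ∑ j' : Bool, q i (j, j') = p₁ i j)
    (hp₂ : ∀ i j, ∑ j' : Bool, q i (j', j) = p₂ i j)
    {A₁ A₂ F G : Set (Fin n → Bool)} {U : Finset (Fin n)} {N : Fin D → ℤ}
    (hbox : BoxReach v U A₁ A₂ F G N) (hFG : 0 < smeas (prodMeas p₁) F * smeas (prodMeas p₂) G)
    {s : ℕ} (hs : ∀ d, s * R d ≤ N d) {w : Fin D → ℤ}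
    (hw : ∀ d, |w d - arrExp (capArr v) (prodMeas q) d| ≤ ζ * R d)
    {J : ℕ} (hJ0 : 0 < J) (hJ : (U.card : ℝ) + J * k ≤ γ * n) (hη0 : 0 ≤ η) (hη1 : η ≤ 1)
    (hη : D * (ζ + 2 * U.card + s) ≤ J * (κ * η / 2)) (hσ0 : 0 ≤ σ) (hσ1 : σ ≤ 1)
    (hσs : σ * n ≤ s) {c : ℕ} (hc : 1 ≤ 2 * (κ / 2) ^ 3 * (c - 1)) :
    κ ^ U.card * ((1 - η) ^ n * ((smeas (prodMeas p₁) F * smeas (prodMeas p₂) G) ^ c -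
      D * (2 * Real.exp (-(n * σ ^ 2 / 16))))) ≤
    smeas (prodMeas q) {r : Fin n → Bool × Bool | (fun i => (r i).1) ∈ A₁ ∧
      (fun i => (r i).2) ∈ A₂ ∧ ∀ d, arrEval (capArr v) r d = w d} := by
  have hRpos : ∀ d, (0 : ℝ) < R d := fun d => by exact_mod_cast hR d
  have hJpos : (0 : ℝ) < J := by exact_mod_cast hJ0
  have hN0 : 0 ≤ N := fun d => (mul_nonneg s.cast_nonneg (hR d).le).trans (hs d)
  obtain ⟨e, he⟩ := hbox
  have hne : F.Nonempty ∧ G.Nonempty := by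
    constructor <;> rw [Set.nonempty_iff_ne_empty] <;> rintro rfl <;> simp [smeas] at hFG
  have heU : ∀ d, |(e d : ℝ)| ≤ U.card * R d := by
    intro d
    obtain ⟨⟨a, ha⟩, b, hb⟩ := hne
    obtain ⟨a', -, b', -, -, h⟩ := he 0 le_rfl hN0 a ha b hb
    rw [add_zero] at h
    rw [← h]
    exact_mod_cast abs_capOn_le hvR U a' b' d
  set Δ : Fin D → ℝ := fun d =>
    w d - e d - s * R d / 2 - ∑ i ∈ Uᶜ, q i (true, true) * v i d with hΔdef
  have hΔ : ∀ d, |Δ d| ≤ (ζ + 2 * U.card + s) / J * J * R d := by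
    intro d
    have hU : |∑ i ∈ U, q i (true, true) * v i d| ≤ U.card * R d := by
      rw [← nsmul_eq_mul]
      refine (abs_sum_le_sum_abs _ _).trans (sum_le_card_nsmul _ _ _ fun i _ => ?_)
      have hq1 : q i (true, true) ≤ 1 := by
        rw [← hq.sum_eq i]
        exact single_le_sum (fun j _ => hq.nonneg hκ i j) (mem_univ _)
      have hvi : |(v i d : ℝ)| ≤ R d := by exact_mod_cast hvR i d
      rw [abs_mul, abs_of_nonneg (hq.nonneg hκ i _)]
      exact (mul_le_of_le_one_left (abs_nonneg _) hq1).trans hvi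
    have h1 := hw d
    rw [arrExp_capArr hq.sum_eq, ← sum_compl_add_sum U] at h1
    rw [div_mul_cancel₀ _ hJpos.ne']
    have hsR : 0 ≤ s * (R d : ℝ) := mul_nonneg s.cast_nonneg (hRpos d).le
    rw [abs_le] at h1 hU ⊢
    have h2 := abs_le.1 (heU d)
    simp only [hΔdef]
    constructor <;> linarith
  obtain ⟨q', hq', hq'₁, hq'₂, hq'η, hq'Δ⟩ := exists_tilted_weight hv hR U hJ0 hJ hΔ hη0 hη1 hκ
    (by rw [← mul_div_assoc, div_le_iff₀ hJpos]; linarith) hq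
  have hq'0 := hq'.nonneg (half_pos hκ)
  set good : Set (Fin n → Bool × Bool) := {r | (fun i => (r i).1) ∈ F ∧ (fun i => (r i).2) ∈ G ∧
    ∀ d, |((∑ i ∈ Uᶜ, capArr v i (r i) d : ℤ) : ℝ) - ∑ i ∈ Uᶜ, q' i (true, true) * v i d| ≤
      σ * n / 2 * R d}
  have hmeas : (smeas (prodMeas p₁) F * smeas (prodMeas p₂) G) ^ c -
      D * (2 * Real.exp (-(n * σ ^ 2 / 16))) ≤ smeas (prodMeas q') good := by
    have h1 := mul_pow_le_sum_prodMeas (half_pos hκ) hc hq' (fun i j => (hq'₁ i j).trans (hp₁ i j))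
      (fun i j => (hq'₂ i j).trans (hp₂ i j)) (f := F.indicator 1) (g := G.indicator 1)
      (Set.indicator_nonneg fun _ _ => zero_le_one) (Set.indicator_nonneg fun _ _ => zero_le_one)
    rw [← smeas_eq_sum_ite, ← smeas_eq_sum_ite] at h1
    have h2 := smeas_exists_abs_sub_gt_le hq'0 hq'.sum_eq hR hvR hσ0 hσ1 Uᶜ
    rw [sub_le_iff_le_add]
    refine h1.trans (le_trans ?_ ((smeas_union_le (prodMeas_nonneg hq'0) _ _).trans
      (add_le_add_right h2 _)))
    rw [smeas_eq_sum_ite]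
    refine sum_le_sum fun r _ => mul_le_mul_of_nonneg_left ?_ (prodMeas_nonneg hq'0 r)
    have hc0 : c ≠ 0 := by
      rintro rfl
      nlinarith [pow_pos (half_pos hκ) 3, Nat.cast_zero (R := ℝ)]
    by_cases hF : (fun i => (r i).1) ∈ F
    · by_cases hG : (fun i => (r i).2) ∈ G
      · have hr : r ∈ good ∪ {r | ∃ d, σ * n / 2 * R d <
            |((∑ i ∈ Uᶜ, capArr v i (r i) d : ℤ) : ℝ) -
              ∑ i ∈ Uᶜ, q' i (true, true) * v i d|} := by
          by_cases h : ∃ d, σ * n / 2 * R d < |((∑ i ∈ Uᶜ, capArr v i (r i) d : ℤ) : ℝ) -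
              ∑ i ∈ Uᶜ, q' i (true, true) * v i d|
          · exact .inr h
          · exact .inl ⟨hF, hG, fun d => not_lt.1 fun hd => h ⟨d, hd⟩⟩
        simp only [Set.indicator_of_mem hr, Set.indicator_of_mem hF, Set.indicator_of_mem hG,
          Pi.one_apply, mul_one, one_pow, le_refl]
      · simp only [Set.indicator_of_notMem hG, mul_zero, zero_pow hc0]
        exact Set.indicator_nonneg (fun _ _ => zero_le_one) r
    · simp only [Set.indicator_of_notMem hF, zero_mul, zero_pow hc0]
      exact Set.indicator_nonneg (fun _ _ => zero_le_one) r
  have hsub : good ⊆ {r | ∃ r' ∈ {r : Fin n → Bool × Bool | (fun i => (r i).1) ∈ A₁ ∧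
      (fun i => (r i).2) ∈ A₂ ∧ ∀ d, arrEval (capArr v) r d = w d}, ∀ i ∉ U, r' i = r i} := by
    rintro r ⟨hF, hG, hr⟩
    have hrd : ∀ d, |(w d - e d - (∑ i ∈ Uᶜ, capArr v i (r i) d : ℤ) : ℝ) - s * R d / 2| ≤
        s * R d / 2 := fun d => by
      have h1 := abs_le.1 ((hr d).trans (mul_le_mul_of_nonneg_right
        (div_le_div_of_nonneg_right hσs zero_le_two) (hRpos d).le))
      rw [hq'Δ] at h1
      simp only [hΔdef] at h1
      exact abs_le.2 ⟨by linarith, by linarith⟩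
    obtain ⟨a, ha, b, hb, hab, hcap⟩ := he (fun d => w d - e d - ∑ i ∈ Uᶜ, capArr v i (r i) d)
      (fun d => by
        have := (abs_le.1 (hrd d)).1
        exact_mod_cast (by linarith : (0 : ℝ) ≤ w d - e d - (∑ i ∈ Uᶜ, capArr v i (r i) d : ℤ)))
      (fun d => by
        have := (abs_le.1 (hrd d)).2
        have h : (w d - e d - (∑ i ∈ Uᶜ, capArr v i (r i) d : ℤ) : ℝ) ≤ s * R d := by linarith
        exact le_trans (by exact_mod_cast h) (hs d)) _ hF _ hG
    refine ⟨fun i => (a i, b i), ⟨ha, hb, fun d => ?_⟩, fun i hi =>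
      Prod.ext (hab i hi).1 (hab i hi).2⟩
    rw [arrEval, ← sum_compl_add_sum U, sum_capArr_eq_capOn v U, hcap]
    have : ∑ i ∈ Uᶜ, capArr v i (a i, b i) d = ∑ i ∈ Uᶜ, capArr v i (r i) d :=
      sum_congr rfl fun i hi => by
        rw [(hab i (mem_compl.1 hi)).1, (hab i (mem_compl.1 hi)).2]
    rw [this, Pi.add_apply]
    ring
  refine le_trans ?_ (pow_mul_smeas_cylinder_le hκ hq _ U)
  refine mul_le_mul_of_nonneg_left ?_ (pow_nonneg hκ.le _)
  refine le_trans ?_ ((pow_mul_smeas_le_of_le (sub_nonneg.2 hη1) hq'0 hq'η good).trans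
    (smeas_mono (prodMeas_nonneg (hq.nonneg hκ)) hsub))
  exact mul_le_mul_of_nonneg_left hmeas (pow_nonneg (sub_nonneg.2 hη1) _)

end Tilt

/-! ### Choice of the parameters -/

section Parameters

variable {n D : ℕ}

lemma exists_box {κ γ σ τ B C₁ l₀ : ℝ} (hκ : 0 < κ) (hτ : 0 < τ) {k : ℕ}
    (hB : (20 / κ + 1) ^ k - 1 = B) (hC₁ : (k + 1) * (1 + 3 * D * (1 + B)) = C₁)
    (hγ : C₁ * σ ≤ γ) (hτκ : (20 / κ + 1) ^ k * τ ≤ κ / 20)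
    {p r : Fin n → Bool → ℝ} (hp : IsWeight κ p) (hr : IsWeight κ r)
    {v : Fin n → Fin D → ℤ} {R : Fin D → ℤ} (hv : Generating γ R k v)
    (hR : ∀ d, 0 < R d) {s L : ℕ} (hL : ∀ d, R d < 2 ^ L) (hs : s ≤ 2 * (σ * n))
    (hLσ : L ≤ σ * n) {A₁ A₂ : Set (Fin n → Bool)} (hl₀n : l₀ ≤ σ * τ * n)
    (hl₀ : Real.exp (-l₀) ≤ smeas (prodMeas p) A₁ * smeas (prodMeas r) A₂) :
    ∃ F G U N, BoxReach v U A₁ A₂ F G N ∧ (∀ d, s * R d ≤ N d) ∧ U.card ≤ C₁ * σ * n ∧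
      Real.exp (-(σ * τ * (1 + 3 * D * B) * n)) ≤
        smeas (prodMeas p) F * smeas (prodMeas r) G := by
  have hB0 : 0 ≤ B := by
    rw [← hB]
    exact sub_nonneg.2 (one_le_pow₀ (by linarith [show 0 ≤ 20 / κ by positivity]))
  have hσn : 0 ≤ σ * n := by linarith [L.cast_nonneg (α := ℝ)]
  have hT : ((D * (s + L) : ℕ) : ℝ) ≤ 3 * D * (σ * n) := by
    push_cast
    nlinarith [mul_le_mul_of_nonneg_left (add_le_add hs hLσ) (D.cast_nonneg (α := ℝ))]
  have hτB : 0 ≤ B * τ := mul_nonneg hB0 hτ.le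
  have hl : l₀ + (D * (s + L) : ℕ) * (τ + B * τ) ≤ (1 + 3 * D * (1 + B)) * (σ * n) * τ := by
    nlinarith [mul_le_mul_of_nonneg_right hT (add_nonneg hτ.le hτB)]
  have hbudget : k * (l₀ + (D * (s + L) : ℕ) * (τ + B * τ)) ≤ C₁ * σ * n * τ := by
    have h0 : 0 ≤ (1 + 3 * D * (1 + B)) * (σ * n) * τ := by positivity
    rw [← hC₁]
    nlinarith [mul_le_mul_of_nonneg_left hl (k.cast_nonneg (α := ℝ))]
  obtain ⟨N, ⟨F, G, U, l, hbox, hFG, hl', hU⟩, hN⟩ := exists_progress hκ hτ hp hr hv hR hτκ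
    (by rw [hB]) hL hl₀ (hbudget.trans (by gcongr))
  refine ⟨F, G, U, N, hbox, hN, ?_, ?_⟩
  · have hl0 : 0 ≤ l := by
      have := hFG.trans (smeas_mul_smeas_le_one hκ hp hr F G)
      rw [Real.exp_le_one_iff] at this
      linarith
    have := mul_nonneg k.cast_nonneg hl0 (α := ℝ)
    exact le_of_mul_le_mul_right (by linarith) hτ
  · refine le_trans (Real.exp_le_exp.2 (neg_le_neg ?_)) hFG
    nlinarith [mul_le_mul_of_nonneg_right hT hτB]

lemma one_sub_pow_lt_mul {κ ε σ b K x : ℝ} (hκ : 0 < κ) (hκ1 : κ < 1) (hε : 0 < ε)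
    (hε1 : ε < 1) {u c : ℕ} (hU : u ≤ K * n) (hKκ : K * -Real.log κ ≤ ε / 4)
    (hx : Real.exp (-(b * n)) ≤ x) (hbσ : c * b ≤ σ ^ 2 / 32) (hbε : c * b ≤ ε / 4)
    (hnD : 128 * D ≤ n * σ ^ 2) (hnε : 4 ≤ ε * n) :
    (1 - ε) ^ n < κ ^ u * ((1 - ε / 8) ^ n * (x ^ c -
      D * (2 * Real.exp (-(n * σ ^ 2 / 16))))) := by
  have h1 : Real.exp (-(ε / 4 * n)) ≤ κ ^ u := by
    rw [← Real.exp_log (pow_pos hκ _), Real.log_pow, Real.exp_le_exp]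
    have := Real.log_neg hκ hκ1
    nlinarith [mul_le_mul_of_nonneg_right hU (neg_nonneg.2 this.le),
      mul_le_mul_of_nonneg_right hKκ n.cast_nonneg]
  have h2 : Real.exp (-(ε / 4 * n)) ≤ (1 - ε / 8) ^ n := by
    rw [show -(ε / 4 * n) = n * -(2 * (ε / 8)) by ring, Real.exp_nat_mul]
    exact pow_le_pow_left₀ (Real.exp_pos _).le
      (exp_neg_two_mul_le (by linarith) (by linarith)) n
  have h3 : 1 / 2 * Real.exp (-(ε / 4 * n)) ≤
      x ^ c -
        D * (2 * Real.exp (-(n * σ ^ 2 / 16))) := by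
    have h4 := pow_le_pow_left₀ (Real.exp_pos _).le hx c
    rw [← Real.exp_nat_mul] at h4
    have h5 : Real.exp (-(n * σ ^ 2 / 16)) ≤
        Real.exp (-(n * σ ^ 2 / 32)) * Real.exp (c * -(b * n)) := by
      rw [← Real.exp_add, Real.exp_le_exp]
      linarith [mul_le_mul_of_nonneg_right hbσ (n.cast_nonneg (α := ℝ))]
    have h6 : Real.exp (-(ε / 4 * n)) ≤ Real.exp (c * -(b * n)) := by
      rw [Real.exp_le_exp]
      linarith [mul_le_mul_of_nonneg_right hbε (n.cast_nonneg (α := ℝ))]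
    have h7 : D * (4 * Real.exp (-(n * σ ^ 2 / 32))) ≤ 1 := by
      rw [Real.exp_neg, ← mul_assoc, ← div_eq_mul_inv, div_le_one (Real.exp_pos _)]
      linarith [Real.add_one_le_exp (n * σ ^ 2 / 32)]
    set E := Real.exp (c * -(b * n))
    have hE : 0 < E := Real.exp_pos _
    have h8 := mul_le_mul_of_nonneg_left h5 (D.cast_nonneg (α := ℝ))
    nlinarith [mul_le_mul_of_nonneg_right h7 hE.le]
  have h9 : (1 - ε) ^ n ≤ Real.exp (-(ε / 4 * n)) * (Real.exp (-(ε / 4 * n)) *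
      (Real.exp (-(ε / 4 * n)) * Real.exp (-(ε / 4 * n)))) := by
    rw [← Real.exp_add, ← Real.exp_add, ← Real.exp_add,
      show -(ε / 4 * n) + (-(ε / 4 * n) + (-(ε / 4 * n) + -(ε / 4 * n))) = n * -ε by ring,
      Real.exp_nat_mul]
    exact pow_le_pow_left₀ (by linarith) (Real.one_sub_le_exp_neg ε) n
  have h10 : Real.exp (-(ε / 4 * n)) < 1 / 2 := by
    rw [Real.exp_neg, inv_eq_one_div, one_div_lt_one_div (Real.exp_pos _) two_pos]
    have : Real.exp 1 ≤ Real.exp (ε / 4 * n) := Real.exp_le_exp.2 (by linarith)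
    linarith [Real.exp_one_gt_d9]
  have hE := Real.exp_pos (-(ε / 4 * n))
  refine h9.trans_lt (lt_of_lt_of_le ?_ (mul_le_mul h1 (mul_le_mul h2 h3 (by positivity)
    (hE.le.trans h2)) (by positivity) (pow_nonneg hκ.le _)))
  gcongr

lemma one_sub_pow_lt_smeas {κ γ ε σ τ ζ δ B C₁ : ℝ} (hκ : 0 < κ) (hκ1 : κ < 1) (hτ : 0 < τ)
    (hε : 0 < ε) (hε1 : ε < 1) {k : ℕ}
    (hB : (20 / κ + 1) ^ k - 1 = B) (hC₁ : (k + 1) * (1 + 3 * D * (1 + B)) = C₁)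
    (hσ0 : 0 < σ) (hσ1 : σ ≤ 1) (hσγ : C₁ * σ ≤ γ / 2) (hσκ : C₁ * σ * -Real.log κ ≤ ε / 4)
    (hζ : D * (ζ + (2 * C₁ + 2) * σ) ≤ γ * κ * ε / (64 * (k + 1)))
    (hτκ : (20 / κ + 1) ^ k * τ ≤ κ / 20) {c : ℕ} (hc : 1 ≤ 2 * (κ / 2) ^ 3 * (c - 1))
    (hcσ : c * (σ * τ * (1 + 3 * D * B)) ≤ σ ^ 2 / 32)
    (hcε : c * (σ * τ * (1 + 3 * D * B)) ≤ ε / 4)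
    (hδ0 : 0 < δ) (hδ1 : δ ≤ 1 / 2) (hδ : 2 * δ ≤ σ * τ)
    (hnσ : 1 ≤ σ * n) (hnγ : 4 * (k + 1) ≤ γ * n) (hnD : 128 * D ≤ n * σ ^ 2) (hnε : 4 ≤ ε * n)
    {L : ℕ} (hnL : L ≤ σ * n) {R : Fin D → ℤ} (hR : ∀ d, 0 < R d) (hL : ∀ d, R d < 2 ^ L)
    {q : Fin n → Bool × Bool → ℝ} (hq : IsWeight κ q) {p₁ p₂ : Fin n → Bool → ℝ}
    (hp₁ : ∀ i j, ∑ j' : Bool, q i (j, j') = p₁ i j)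
    (hp₂ : ∀ i j, ∑ j' : Bool, q i (j', j) = p₂ i j)
    {v : Fin n → Fin D → ℤ} (hvR : ∀ i d, |v i d| ≤ R d) (hv : Generating γ R k v)
    {w : Fin D → ℤ} (hw : ∀ d, |w d - arrExp (capArr v) (prodMeas q) d| ≤ ζ * n * R d)
    {A₁ A₂ : Set (Fin n → Bool)}
    (hA : (1 - δ) ^ n < smeas (prodMeas p₁) A₁ * smeas (prodMeas p₂) A₂) :
    (1 - ε) ^ n < smeas (prodMeas q) {r : Fin n → Bool × Bool | (fun i => (r i).1) ∈ A₁ ∧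
      (fun i => (r i).2) ∈ A₂ ∧ ∀ d, arrEval (capArr v) r d = w d} := by
  have hp : IsWeight κ p₁ := ⟨fun i => by rw [← hq.sum_eq i, Fintype.sum_prod_type]; simp only [hp₁],
    fun i j => by
      rw [← hp₁, Fintype.sum_bool]
      linarith [hq.le i (j, true), hq.nonneg hκ i (j, false)]⟩
  have hr : IsWeight κ p₂ := ⟨fun i => by
      rw [← hq.sum_eq i, Fintype.sum_prod_type_right]; simp only [hp₂],
    fun i j => by
      rw [← hp₂, Fintype.sum_bool]
      linarith [hq.le i (true, j), hq.nonneg hκ i (false, j)]⟩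
  have hn0 : (0 : ℝ) < n := by
    rw [Nat.cast_pos, Nat.pos_iff_ne_zero]
    rintro rfl
    norm_num at hnσ
  have hk : (0 : ℝ) < k + 1 := by positivity
  have hB0 : 0 ≤ B := by
    rw [← hB]
    exact sub_nonneg.2 (one_le_pow₀ (by linarith [show 0 ≤ 20 / κ by positivity]))
  have hC₁0 : 0 ≤ C₁ := by rw [← hC₁]; positivity
  have hγ : 0 ≤ γ := by nlinarith
  obtain ⟨F, G, U, N, hbox, hN, hU, hFG⟩ := exists_box hκ hτ hB hC₁ (by linarith) hτκ hp hr hv hR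
    hL (s := ⌈σ * n⌉₊) (by linarith [Nat.ceil_lt_add_one (zero_le_one.trans hnσ)]) hnL
    (l₀ := 2 * δ * n) (by nlinarith) (by
      refine le_trans ?_ hA.le
      rw [show -(2 * δ * n) = n * -(2 * δ) by ring, Real.exp_nat_mul]
      exact pow_le_pow_left₀ (Real.exp_pos _).le (exp_neg_two_mul_le hδ0.le hδ1) n)
  set J : ℕ := ⌊γ * n / (2 * (k + 1))⌋₊ with hJdef
  have hJ2 : (J : ℝ) ≤ γ * n / (2 * (k + 1)) := Nat.floor_le (by positivity)
  have hJ1 : γ * n / (4 * (k + 1)) ≤ J := by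
    have h1 := Nat.lt_floor_add_one (γ * n / (2 * (k + 1)))
    have h2 : γ * n / (2 * (k + 1)) = 2 * (γ * n / (4 * (k + 1))) := by
      field_simp
      norm_num
    have h3 : 1 ≤ γ * n / (4 * (k + 1)) := by rwa [one_le_div (by positivity)]
    linarith
  have hJ0 : 0 < J := by
    have : (0 : ℝ) < J := lt_of_lt_of_le (div_pos (by linarith) (by positivity)) hJ1
    exact_mod_cast this
  refine lt_of_lt_of_le ?_ (hbox.le_smeas hκ hR hvR hv hq hp₁ hp₂ ((Real.exp_pos _).trans_le hFG)
    hN hw hJ0 ?_ (η := ε / 8) (by linarith) (by linarith) ?_ hσ0.le hσ1 (Nat.le_ceil _) hc)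
  · exact one_sub_pow_lt_mul hκ hκ1 hε hε1 hU hσκ hFG hcσ hcε hnD hnε
  · have h1 : (J : ℝ) * k ≤ γ * n / 2 := by
      have h2 : γ * n / (2 * (k + 1)) * (k + 1) = γ * n / 2 := by field_simp
      linarith [mul_le_mul_of_nonneg_right hJ2 hk.le, J.cast_nonneg (α := ℝ)]
    linarith [mul_le_mul_of_nonneg_right hσγ hn0.le]
  · have hs : (⌈σ * n⌉₊ : ℝ) ≤ 2 * (σ * n) := by
      linarith [Nat.ceil_lt_add_one (zero_le_one.trans hnσ)]
    calc (D : ℝ) * (ζ * n + 2 * U.card + ⌈σ * n⌉₊)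
        ≤ D * (ζ * n + 2 * (C₁ * σ * n) + 2 * (σ * n)) := by gcongr
      _ = D * (ζ + (2 * C₁ + 2) * σ) * n := by ring
      _ ≤ γ * κ * ε / (64 * (k + 1)) * n := by gcongr
      _ = γ * n / (4 * (k + 1)) * (κ * (ε / 8) / 2) := by field_simp; ring
      _ ≤ J * (κ * (ε / 8) / 2) := by gcongr

lemma eventually_mul_log_add_one_le (C : ℕ) {σ : ℝ} (hσ : 0 < σ) :
    ∀ᶠ n : ℕ in Filter.atTop, ((C * (Nat.log 2 n + 1) : ℕ) : ℝ) ≤ σ * n := by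
  have hlog2 := Real.log_pos one_lt_two
  have hc : 0 < σ / (2 * (C + 1)) * Real.log 2 := by positivity
  filter_upwards [tendsto_natCast_atTop_atTop.eventually
      (Real.isLittleO_log_id_atTop.bound hc),
    tendsto_natCast_atTop_atTop.eventually_ge_atTop (2 * (C + 1) / σ)] with n h1 h2
  have h3 : (Nat.log 2 n : ℝ) ≤ σ / (2 * (C + 1)) * n := by
    have := Real.natLog_le_logb n 2
    refine this.trans ?_
    rw [Real.logb, Nat.cast_ofNat, div_le_iff₀ hlog2]
    refine (le_abs_self _).trans (h1.trans_eq ?_)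
    simp
    ring
  have h4 : 1 ≤ σ / (2 * (C + 1)) * n := by
    rw [div_le_iff₀ hσ] at h2
    rw [div_mul_eq_mul_div, one_le_div (by positivity)]
    linarith
  push_cast
  calc (C : ℝ) * (Nat.log 2 n + 1)
      ≤ (C + 1) * (σ / (2 * (C + 1)) * n + σ / (2 * (C + 1)) * n) := by gcongr; linarith
    _ = σ * n := by field_simp; ring

lemma eventually_mul_le (a : ℝ) {b : ℝ} (hb : 0 < b) : ∀ᶠ x in nhdsWithin 0 (Set.Ioi 0), a * x ≤ b :=
  nhdsWithin_le_nhds ((by fun_prop : Continuous fun x => a * x).continuousAt.eventually_le_const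
    (by simpa using hb))

end Parameters

/-- **Cross-intersection theorem.** -/
theorem cross_intersection_theorem (D C k : ℕ) :
    ∃ θ₁ > (0:ℝ), ∀ κ ∈ Set.Ioo (0:ℝ) θ₁, ∀ γ ∈ Set.Ioo (0:ℝ) θ₁, ∀ ε ∈ Set.Ioo (0:ℝ) θ₁,
    ∃ θ₂ > (0:ℝ), ∀ ζ ∈ Set.Ioo (0:ℝ) θ₂,
    ∃ δ₀ > (0:ℝ), ∃ n₀ : ℕ, ∀ n, n₀ ≤ n → ∀ δ ∈ Set.Ioc (0:ℝ) δ₀,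
    ∀ R : Fin D → ℤ, (∀ d, 0 < R d) → (∀ d, (R d : ℝ) < (n : ℝ) ^ C) →
    ∀ q : Fin n → Bool × Bool → ℝ,
      (∀ i, ∑ jj : Bool × Bool, q i jj = 1) →
      (∀ i jj, q i jj ∈ Set.Icc κ (1 - κ)) →
    ∀ p₁ p₂ : Fin n → Bool → ℝ,
      (∀ i j, ∑ j' : Bool, q i (j, j') = p₁ i j) →
      (∀ i j, ∑ j' : Bool, q i (j', j) = p₂ i j) →
    ∀ v : Fin n → Fin D → ℤ,
      (∀ i, rnorm (fun d => (R d : ℝ)) (fun d => (v i d : ℝ)) ≤ 1) →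
      RobustlyGenerating γ (fun d => (R d : ℝ)) k v →
    ∀ w : Fin D → ℤ,
      rnorm (fun d => (R d : ℝ))
        (fun d => (w d : ℝ) - arrExp (capArr v) (prodMeas q) d) < ζ * n →
    ∀ A₁ A₂ : Set (Fin n → Bool),
      (1 - δ) ^ n < smeas (prodMeas p₁) A₁ * smeas (prodMeas p₂) A₂ →
      (1 - ε) ^ n <
        smeas (prodMeas q)
          {r : Fin n → Bool × Bool | (fun i => (r i).1) ∈ A₁ ∧ (fun i => (r i).2) ∈ A₂ ∧
            ∀ d, arrEval (capArr v) r d = w d} := by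
  refine ⟨1, one_pos, fun κ ⟨hκ, hκ1⟩ γ ⟨hγ, _⟩ ε ⟨hε, hε1⟩ => ?_⟩
  obtain ⟨B, hB⟩ : ∃ B, (20 / κ + 1) ^ k - 1 = B := ⟨_, rfl⟩
  obtain ⟨C₁, hC₁⟩ : ∃ C₁, (k + 1) * (1 + 3 * D * (1 + B)) = C₁ := ⟨_, rfl⟩
  obtain ⟨c, hc⟩ : ∃ c : ℕ, 1 ≤ 2 * (κ / 2) ^ 3 * ((c : ℝ) - 1) := by
    obtain ⟨c, hc⟩ := exists_nat_ge (1 / (2 * (κ / 2) ^ 3))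
    refine ⟨c + 1, ?_⟩
    rwa [Nat.cast_succ, add_sub_cancel_right, mul_comm, ← div_le_iff₀ (by positivity)]
  obtain ⟨E, hE⟩ : ∃ E, γ * κ * ε / (64 * (k + 1)) = E := ⟨_, rfl⟩
  have hE0 : 0 < E := by rw [← hE]; positivity
  obtain ⟨σ, ⟨⟨⟨hσ1, hσγ⟩, hσκ⟩, hσE⟩, hσ0⟩ := ((((eventually_mul_le 1 one_pos).and
    (eventually_mul_le C₁ (half_pos hγ))).and
    (eventually_mul_le (C₁ * -Real.log κ) (show 0 < ε / 4 by positivity))).and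
    (eventually_mul_le (D * (2 * C₁ + 2)) (half_pos hE0))).and self_mem_nhdsWithin |>.exists
  replace hσ0 : 0 < σ := hσ0
  obtain ⟨τ, ⟨⟨hτκ, hτσ⟩, hτε⟩, hτ⟩ := ((eventually_mul_le ((20 / κ + 1) ^ k)
    (show 0 < κ / 20 by positivity)).and
    (eventually_mul_le (c * (σ * (1 + 3 * D * B))) (show 0 < σ ^ 2 / 32 by positivity))).and
    (eventually_mul_le (c * (σ * (1 + 3 * D * B))) (show 0 < ε / 4 by positivity))
    |>.and self_mem_nhdsWithin |>.exists
  replace hτ : 0 < τ := hτ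
  obtain ⟨θ, hθE, hθ⟩ := (eventually_mul_le D (half_pos hE0)).and self_mem_nhdsWithin |>.exists
  have hlin : ∀ a b : ℝ, 0 < b → ∀ᶠ n : ℕ in Filter.atTop, a ≤ b * n := fun a b hb =>
    (tendsto_natCast_atTop_atTop.const_mul_atTop hb).eventually_ge_atTop a
  obtain ⟨n₀, hn₀⟩ := Filter.eventually_atTop.1 ((((hlin 1 σ hσ0).and
    (hlin (4 * (k + 1)) γ hγ)).and (hlin (128 * D) (σ ^ 2) (by positivity))).and
    (hlin 4 ε hε) |>.and (eventually_mul_log_add_one_le C hσ0))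
  refine ⟨θ, hθ, fun ζ ⟨_, hζ⟩ => ⟨min (1 / 2) (σ * τ / 2), by positivity, n₀, ?_⟩⟩
  intro n hn δ ⟨hδ0, hδ⟩ R hR hRn q hq1 hq p₁ p₂ hp₁ hp₂ v hvR hv w hw A₁ A₂ hA
  obtain ⟨⟨⟨⟨hnσ, hnγ⟩, hnD⟩, hnε⟩, hnL⟩ := hn₀ n hn
  obtain ⟨hδ1, hδ2⟩ := le_min_iff.1 hδ
  have hR' : ∀ d, (0 : ℝ) < R d := fun d => by exact_mod_cast hR d
  have hDζ : D * ζ ≤ E / 2 := (mul_le_mul_of_nonneg_left hζ.le D.cast_nonneg).trans hθE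
  refine one_sub_pow_lt_smeas hκ hκ1 hτ hε hε1 hB hC₁ hσ0 (by linarith) hσγ (by linarith)
    (by rw [hE]; linarith) hτκ hc (by linarith) (by linarith) hδ0 hδ1 (by linarith) hnσ hnγ
    (by linarith) hnε hnL hR (fun d => ?_) ⟨hq1, fun i j => (hq i j).1⟩ hp₁ hp₂ (fun i d => ?_)
    (hv.generating hR) ((rnorm_le_iff hR' ?_).1 hw.le) hA
  · have h1 : (n : ℝ) ^ C ≤ 2 ^ (C * (Nat.log 2 n + 1)) := by
      rw [mul_comm, pow_mul]
      exact pow_le_pow_left₀ n.cast_nonneg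
        (by exact_mod_cast (Nat.lt_pow_succ_log_self one_lt_two n).le) C
    exact_mod_cast (hRn d).trans_le h1
  · have := (rnorm_le_iff hR' zero_le_one).1 (hvR i) d
    rw [one_mul] at this
    exact_mod_cast this
  · exact (Real.iSup_nonneg fun d => div_nonneg (abs_nonneg _) (hR' d).le).trans hw.le
end
end

section
/- Correlation inequality for product measures (general form). For all κ,ε ∈ (0,1) there exist δ₀ > 0 and n₀ such that for all n ≥ n₀ and δ ∈ (0,δ₀] the following holds. Let S be a finite set and (J_s : s∈S) finite sets, and let μ_q be a κ-bounded product measure on (Π_{s∈S} J_s)ⁿ with marginals (μ_{p_s} : s∈S). If 𝒜_s ⊆ J_sⁿ for each s∈S satisfy Π_{s∈S} μ_{p_s}(𝒜_s) > (1−δ)ⁿ, then μ_q(Π_{s∈S} 𝒜_s) > (1−ε)ⁿ. -/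
open Finset

noncomputable section

/-- The mean of a function of one coordinate is computed by the marginal. -/
lemma sum_marginal_mul {S : Type*} [Fintype S] [DecidableEq S] {J : S → Type*}
    [∀ s, Fintype (J s)] {q : (∀ s, J s) → ℝ} {s : S} {p : J s → ℝ}
    (hp : ∀ j, p j =
      ∑ a : (∀ s, J s), ({a' : ∀ s', J s' | a' s = j} : Set _).indicator q a)
    (h : J s → ℝ) : ∑ j, p j * h j = ∑ a, q a * h (a s) := by
  classical
  simp only [hp, Finset.sum_mul]
  rw [Finset.sum_comm]
  refine Finset.sum_congr rfl fun a _ => ?_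
  rw [Finset.sum_eq_single (a s)]
  · simp
  · intro j _ hj
    simp [hj.symm]
  · simp

/-- The marginal of a weight bounded below by `κ` is bounded below by `κ`. -/
lemma le_marginal {S : Type*} [Fintype S] [DecidableEq S] {J : S → Type*}
    [∀ s, Fintype (J s)] {q : (∀ s, J s) → ℝ} {s : S} {p : J s → ℝ} {κ : ℝ}
    (hκ : 0 ≤ κ) (hq : ∀ a, κ ≤ q a) (hne : Nonempty (∀ s, J s))
    (hp : ∀ j, p j =
      ∑ a : (∀ s, J s), ({a' : ∀ s', J s' | a' s = j} : Set _).indicator q a)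
    (j : J s) : κ ≤ p j := by
  classical
  obtain ⟨a₀⟩ := hne
  rw [hp]
  have h1 : ∀ a ∈ (univ : Finset (∀ s, J s)),
      0 ≤ ({a' : ∀ s', J s' | a' s = j} : Set _).indicator q a :=
    fun a _ => Set.indicator_nonneg (fun b _ => hκ.trans (hq b)) a
  refine le_trans ?_ (Finset.single_le_sum h1 (mem_univ (Function.update a₀ s j)))
  simpa using hq _

lemma sub_two_mul_sq_le_log {g : ℝ} (hg : -(1 / 2) ≤ g) : g - 2 * g ^ 2 ≤ Real.log (1 + g) := by
  have h0 : 0 < 1 + g := by linarith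
  refine le_trans ?_ (Real.one_sub_inv_le_log_of_pos h0)
  have h1 : 1 - (1 + g)⁻¹ = g / (1 + g) := by field_simp; ring
  rw [h1, le_div_iff₀ h0]
  nlinarith [mul_nonneg (sq_nonneg g) (by linarith : (0 : ℝ) ≤ 1 + 2 * g)]

lemma one_add_sum_sub_one_le_prod {ι : Type*} (t : Finset ι) (X : ι → ℝ) (hX : ∀ i, 1 ≤ X i) :
    1 + ∑ i ∈ t, (X i - 1) ≤ ∏ i ∈ t, X i := by
  classical
  induction t using Finset.induction_on with
  | empty => simp
  | insert i t hi ih =>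
    rw [Finset.sum_insert hi, Finset.prod_insert hi]
    have h0 : 0 ≤ ∑ i ∈ t, (X i - 1) := Finset.sum_nonneg fun i _ => by linarith [hX i]
    nlinarith [hX i, mul_nonneg (by linarith [hX i] : 0 ≤ X i - 1) h0]

/-- Moments of order `m` of a nonnegative function of mean one are at least one. -/
lemma one_le_sum_mul_pow {ι : Type*} [Fintype ι] {p f : ι → ℝ} (hp : ∀ j, 0 ≤ p j)
    (hp1 : ∑ j, p j = 1) (hf : ∀ j, 0 ≤ f j) (hpf : ∑ j, p j * f j = 1) (m : ℕ) :
    1 ≤ ∑ j, p j * f j ^ m := by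
  have h : ∑ j, p j * (1 + m * (f j - 1)) = 1 := by
    have : ∀ j, p j * (1 + m * (f j - 1)) = p j + m * (p j * f j) - m * p j := fun j => by ring
    simp only [this, Finset.sum_sub_distrib, Finset.sum_add_distrib, ← Finset.mul_sum, hp1, hpf]
    ring
  rw [← h]
  refine Finset.sum_le_sum fun j _ => mul_le_mul_of_nonneg_left ?_ (hp j)
  have := one_add_mul_le_pow (a := f j - 1) (by linarith [hf j]) m
  simpa using this

/-- For a function of mean one close to `1`, the excess of a high moment dominates the defect of
the mean logarithm. -/
lemma moment_add_log_nonneg {ι : Type*} [Fintype ι] {p f : ι → ℝ} {κ : ℝ} {M : ℕ} (k : ℕ)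
    (hκ : 0 < κ) (hκ1 : κ ≤ 1) (hM : 4 ≤ κ * M) (hp : ∀ j, κ ≤ p j) (hp1 : ∑ j, p j = 1)
    (hpf : ∑ j, p j * f j = 1) (hf : ∀ j, f j ≤ 1 + κ / M) :
    (∀ j, 0 < f j) ∧ 0 ≤ κ * ((∑ j, p j * f j ^ (2 * M * k)) - 1)
      + (1 - κ) * ((2 * M * k : ℕ) * ∑ j, p j * Real.log (f j)) := by
  have hM4 : (4 : ℝ) ≤ M := by nlinarith [(Nat.cast_nonneg M : (0 : ℝ) ≤ M)]
  have hM0 : (0 : ℝ) < M := by linarith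
  have hg0 : ∑ j, p j * (f j - 1) = 0 := by
    simp only [mul_sub, Finset.sum_sub_distrib, hpf, mul_one, hp1, sub_self]
  have hlow : ∀ j, -(1 / (M : ℝ)) ≤ f j - 1 := by
    intro j
    have h1 : ∑ i, p i * (κ / M - (f i - 1)) = κ / M := by
      simp only [mul_sub _ (κ / (M : ℝ)), Finset.sum_sub_distrib, hg0, ← Finset.sum_mul, hp1]
      ring
    have h2 : p j * (κ / M - (f j - 1)) ≤ κ / M := by
      refine (Finset.single_le_sum (f := fun i => p i * (κ / M - (f i - 1)))
        (fun i _ => mul_nonneg (hκ.le.trans (hp i)) ?_) (mem_univ j)).trans_eq h1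
      linarith [hf i]
    have h3 : κ * (κ / M - (f j - 1)) ≤ κ * (1 / M) := by
      have := mul_le_mul_of_nonneg_right (hp j) (by linarith [hf j] : 0 ≤ κ / M - (f j - 1))
      calc _ ≤ _ := this
        _ ≤ _ := h2
        _ = _ := by ring
    have h4 := le_of_mul_le_mul_left h3 hκ
    have : 0 ≤ κ / M := by positivity
    linarith
  have hM14 : 1 / (M : ℝ) ≤ 1 / 4 := one_div_le_one_div_of_le (by norm_num) hM4
  refine ⟨fun j => by linarith [hlow j], ?_⟩
  set V := ∑ j, p j * (f j - 1) ^ 2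
  have hV0 : 0 ≤ V := Finset.sum_nonneg fun j _ => mul_nonneg (hκ.le.trans (hp j)) (sq_nonneg _)
  have hX : 1 + k * M ^ 2 * V ≤ ∑ j, p j * f j ^ (2 * M * k) := by
    have h : ∑ j, p j * (1 + k * ((1 + M * (f j - 1)) ^ 2 - 1)) = 1 + k * M ^ 2 * V := by
      have : ∀ j, p j * (1 + k * ((1 + M * (f j - 1)) ^ 2 - 1))
          = p j + 2 * k * M * (p j * (f j - 1)) + k * M ^ 2 * (p j * (f j - 1) ^ 2) :=
        fun j => by ring
      simp only [this, Finset.sum_add_distrib, ← Finset.mul_sum, hp1, hg0]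
      ring
    rw [← h]
    refine Finset.sum_le_sum fun j _ => mul_le_mul_of_nonneg_left ?_ (hκ.le.trans (hp j))
    have hb : 0 ≤ 1 + M * (f j - 1) := by
      have := mul_le_mul_of_nonneg_left (hlow j) hM0.le
      rw [mul_neg, mul_one_div_cancel hM0.ne'] at this
      linarith
    have h1 : 1 + M * (f j - 1) ≤ f j ^ M := by
      have := one_add_mul_le_pow (a := f j - 1) (by linarith [hlow j]) M
      simpa using this
    have h2 := one_add_mul_le_pow (a := (1 + M * (f j - 1)) ^ 2 - 1)
      (by linarith [sq_nonneg (1 + M * (f j - 1))]) k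
    refine h2.trans ?_
    rw [add_sub_cancel, mul_comm 2 M, pow_mul, pow_mul]
    gcongr
  have hL : -(2 * V) ≤ ∑ j, p j * Real.log (f j) := by
    have h : ∑ j, p j * ((f j - 1) - 2 * (f j - 1) ^ 2) = -(2 * V) := by
      have : ∀ j, p j * ((f j - 1) - 2 * (f j - 1) ^ 2)
          = p j * (f j - 1) - 2 * (p j * (f j - 1) ^ 2) := fun j => by ring
      simp only [this, Finset.sum_sub_distrib, ← Finset.mul_sum, hg0]
      ring
    rw [← h]
    refine Finset.sum_le_sum fun j _ => mul_le_mul_of_nonneg_left ?_ (hκ.le.trans (hp j))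
    have := sub_two_mul_sq_le_log (g := f j - 1) (by linarith [hlow j])
    simpa using this
  push_cast
  have h1 : κ * (k * M ^ 2 * V) ≤ κ * ((∑ j, p j * f j ^ (2 * M * k)) - 1) :=
    mul_le_mul_of_nonneg_left (by linarith) hκ.le
  have h2 : (1 - κ) * (2 * M * k * -(2 * V))
      ≤ (1 - κ) * (2 * M * k * ∑ j, p j * Real.log (f j)) := by
    have : 0 ≤ 1 - κ := by linarith
    gcongr
  have h3 : 0 ≤ (k * M * V) * (κ * M - 4) := mul_nonneg (by positivity) (by linarith)
  have h4 : 0 ≤ κ * (k * M * V) := by positivity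
  nlinarith

/-- Reverse hypercontractivity on one coordinate, for functions of mean one. -/
lemma one_le_sum_mul_prod_pow {κ : ℝ} (hκ : 0 < κ) (hκ1 : κ ≤ 1) {M k : ℕ} (hM : 4 ≤ κ * M)
    (hk : 1 ≤ κ ^ 2 * (1 + κ / M) ^ (2 * M * k))
    {S : Type*} [Fintype S] [DecidableEq S] {J : S → Type*} [∀ s, Fintype (J s)]
    {q : (∀ s, J s) → ℝ} (hq1 : ∑ a, q a = 1) (hq : ∀ a, κ ≤ q a)
    {p : (s : S) → J s → ℝ}
    (hp : ∀ s j, p s j =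
      ∑ a : (∀ s, J s), ({a' : ∀ s', J s' | a' s = j} : Set _).indicator q a)
    (f : (s : S) → J s → ℝ) (hf : ∀ s j, 0 ≤ f s j) (hpf : ∀ s, ∑ j, p s j * f s j = 1) :
    1 ≤ ∑ a, q a * ∏ s, f s (a s) ^ (2 * M * k) := by
  classical
  have hne : Nonempty (∀ s, J s) := by
    by_contra h
    rw [not_nonempty_iff] at h
    simp at hq1
  have hpκ : ∀ s j, κ ≤ p s j := fun s j => le_marginal hκ.le hq hne (hp s) j
  have hp0 : ∀ s j, 0 ≤ p s j := fun s j => hκ.le.trans (hpκ s j)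
  have hp1 : ∀ s, ∑ j, p s j = 1 := fun s => by
    simpa [hq1] using sum_marginal_mul (hp s) (fun _ => 1)
  set C := 2 * M * k
  set P : (∀ s, J s) → ℝ := fun a => ∏ s, p s (a s) with hP
  set X : S → ℝ := fun s => ∑ j, p s j * f s j ^ C with hX
  have hX1 : ∀ s, 1 ≤ X s := fun s => one_le_sum_mul_pow (hp0 s) (hp1 s) (hf s) (hpf s) C
  have hP1 : ∀ a, P a ≤ 1 := fun a => Finset.prod_le_one (fun s _ => hp0 s _) fun s _ => by
    rw [← hp1 s]
    exact Finset.single_le_sum (fun j _ => hp0 s j) (mem_univ _)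
  have hqP : ∀ a, 0 ≤ q a - κ * P a := fun a => by nlinarith [hq a, hP1 a]
  have hPX : ∑ a, P a * ∏ s, f s (a s) ^ C = ∏ s, X s := by
    simp only [hP, hX, ← Finset.prod_mul_distrib]
    rw [Finset.prod_univ_sum, Fintype.piFinset_univ]
  have hsplit : ∑ a, q a * ∏ s, f s (a s) ^ C
      = κ * ∏ s, X s + ∑ a, (q a - κ * P a) * ∏ s, f s (a s) ^ C := by
    rw [← hPX, Finset.mul_sum, ← Finset.sum_add_distrib]
    exact Finset.sum_congr rfl fun a _ => by ring
  rw [hsplit]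
  by_cases hbig : ∃ s j, 1 + κ / M < f s j
  · obtain ⟨s, j, hsj⟩ := hbig
    have h1 : X s ≤ ∏ s, X s := by
      rw [← Finset.mul_prod_erase _ _ (mem_univ s)]
      exact le_mul_of_one_le_right (by linarith [hX1 s])
        (Finset.one_le_prod fun t _ => hX1 t)
    have h2 : κ * (1 + κ / M) ^ C ≤ X s := by
      refine le_trans ?_ (Finset.single_le_sum (f := fun j => p s j * f s j ^ C)
        (fun j _ => mul_nonneg (hp0 s j) (pow_nonneg (hf s j) C)) (mem_univ j))
      have := hp0 s j
      exact mul_le_mul (hpκ s j) (pow_le_pow_left₀ (by positivity) hsj.le C) (by positivity) this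
    have h3 : 0 ≤ ∑ a, (q a - κ * P a) * ∏ s, f s (a s) ^ C :=
      Finset.sum_nonneg fun a _ => mul_nonneg (hqP a)
        (Finset.prod_nonneg fun s _ => pow_nonneg (hf s _) C)
    have h4 := mul_le_mul_of_nonneg_left (h2.trans h1) hκ.le
    have h5 : κ * (κ * (1 + κ / M) ^ C) = κ ^ 2 * (1 + κ / M) ^ C := by ring
    linarith
  · push Not at hbig
    have key := fun s => moment_add_log_nonneg k hκ hκ1 hM (hpκ s) (hp1 s) (hpf s) (hbig s)
    have h1 : ∑ a, (q a - κ * P a) * (1 + C * ∑ s, Real.log (f s (a s)))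
        ≤ ∑ a, (q a - κ * P a) * ∏ s, f s (a s) ^ C := by
      refine Finset.sum_le_sum fun a _ => mul_le_mul_of_nonneg_left ?_ (hqP a)
      have hpos : 0 < ∏ s, f s (a s) := Finset.prod_pos fun s _ => (key s).1 _
      rw [Finset.prod_pow, ← Real.log_prod fun s _ => ((key s).1 _).ne', ← Real.log_pow]
      linarith [Real.log_le_sub_one_of_pos (pow_pos hpos C)]
    have hPs : ∀ s, ∀ h : J s → ℝ, ∑ a, P a * h (a s) = ∑ j, p s j * h j := by
      intro s h
      have e : ∀ a, P a * h (a s) = ∏ t, p t (a t) * (if e : t = s then h (e ▸ a t) else 1) := by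
        intro a
        rw [Finset.prod_mul_distrib, Finset.prod_dite_eq']
        simp [hP]
      simp only [e]
      rw [← Fintype.piFinset_univ, ← Finset.prod_univ_sum
        (f := fun t x => p t x * (if e : t = s then h (e ▸ x) else 1)),
        Finset.prod_eq_single s]
      · simp
      · intro t _ hts
        simp [hts, hp1]
      · simp
    have hP1' : ∑ a, P a = 1 := by
      have := Finset.prod_univ_sum (fun s => (univ : Finset (J s))) p
      rw [Fintype.piFinset_univ] at this
      rw [← this]
      simp [hp1]
    have h2 : ∑ a, (q a - κ * P a) * (1 + C * ∑ s, Real.log (f s (a s)))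
        = (1 - κ) + ∑ s, (1 - κ) * (C * ∑ j, p s j * Real.log (f s j)) := by
      have e1 : ∀ s, ∑ a, (q a - κ * P a) * Real.log (f s (a s))
          = (1 - κ) * ∑ j, p s j * Real.log (f s j) := by
        intro s
        simp only [sub_mul, Finset.sum_sub_distrib, mul_assoc, ← Finset.mul_sum]
        rw [hPs s (fun j => Real.log (f s j)),
          ← sum_marginal_mul (hp s) (fun j => Real.log (f s j))]
        ring
      simp only [mul_add, mul_one, Finset.sum_add_distrib]
      congr 1
      · rw [Finset.sum_sub_distrib, ← Finset.mul_sum, hq1, hP1', mul_one]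
      · simp_rw [mul_left_comm (1 - κ) (C : ℝ), ← e1, Finset.mul_sum]
        rw [Finset.sum_comm]
        exact Finset.sum_congr rfl fun s _ => Finset.sum_congr rfl fun a _ => by ring
    have h3 := mul_le_mul_of_nonneg_left (one_add_sum_sub_one_le_prod univ X hX1) hκ.le
    have h4 : 0 ≤ ∑ s, (κ * (X s - 1) + (1 - κ) * (C * ∑ j, p s j * Real.log (f s j))) :=
      Finset.sum_nonneg fun s _ => (key s).2
    rw [Finset.sum_add_distrib, ← Finset.mul_sum] at h4
    linarith

/-- `(Ω, q)` satisfies the reverse Hölder-type inequality with exponent `C` for the projections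
onto the spaces `(J s, p s)`. -/
def ReverseHolder {S : Type*} [Fintype S] {J : S → Type*} [∀ s, Fintype (J s)] {Ω : Type*}
    [Fintype Ω] (C : ℕ) (π : (s : S) → Ω → J s) (q : Ω → ℝ) (p : (s : S) → J s → ℝ) : Prop :=
  ∀ f : (s : S) → J s → ℝ, (∀ s j, 0 ≤ f s j) →
    (∏ s, ∑ j, p s j * f s j) ^ C ≤ ∑ a, q a * ∏ s, f s (π s a) ^ C

/-- Reverse hypercontractivity on one coordinate. -/
lemma reverseHolder_coord {κ : ℝ} (hκ : 0 < κ) (hκ1 : κ ≤ 1) {M k : ℕ} (hM : 4 ≤ κ * M)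
    (hk0 : k ≠ 0) (hk : 1 ≤ κ ^ 2 * (1 + κ / M) ^ (2 * M * k))
    {S : Type*} [Fintype S] [DecidableEq S] {J : S → Type*} [∀ s, Fintype (J s)]
    {q : (∀ s, J s) → ℝ} (hq1 : ∑ a, q a = 1) (hq : ∀ a, κ ≤ q a)
    {p : (s : S) → J s → ℝ}
    (hp : ∀ s j, p s j =
      ∑ a : (∀ s, J s), ({a' : ∀ s', J s' | a' s = j} : Set _).indicator q a) :
    ReverseHolder (2 * M * k) (fun s a => a s) q p := by
  intro f hf
  have hM0 : M ≠ 0 := by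
    rintro rfl
    norm_num at hM
  have hC : 2 * M * k ≠ 0 := by positivity
  have hq0 : ∀ a, 0 ≤ q a := fun a => hκ.le.trans (hq a)
  have hm0 : ∀ s, 0 ≤ ∑ j, p s j * f s j := fun s => by
    rw [sum_marginal_mul (hp s)]
    exact Finset.sum_nonneg fun a _ => mul_nonneg (hq0 a) (hf s _)
  by_cases hz : ∃ s, ∑ j, p s j * f s j = 0
  · obtain ⟨s, hs⟩ := hz
    rw [Finset.prod_eq_zero (mem_univ s) hs, zero_pow hC]
    exact Finset.sum_nonneg fun a _ => mul_nonneg (hq0 a)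
      (Finset.prod_nonneg fun s _ => pow_nonneg (hf s _) _)
  push Not at hz
  have h := one_le_sum_mul_prod_pow hκ hκ1 hM hk hq1 hq hp
    (fun s j => f s j / ∑ j, p s j * f s j) (fun s j => div_nonneg (hf s j) (hm0 s))
    (fun s => by simp only [← mul_div_assoc, ← Finset.sum_div]; exact div_self (hz s))
  simp only [div_pow, Finset.prod_div_distrib, ← mul_div_assoc, ← Finset.sum_div] at h
  have hpos : 0 < ∏ s, (∑ j, p s j * f s j) ^ (2 * M * k) :=
    Finset.prod_pos fun s _ => pow_pos ((hm0 s).lt_of_ne' (hz s)) _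
  rw [← Finset.prod_pow]
  rwa [one_le_div hpos] at h

lemma sum_fin_succ_fun {n : ℕ} {J : Type*} [Fintype J] (F : (Fin (n + 1) → J) → ℝ) :
    ∑ x, F x = ∑ j, ∑ y : Fin n → J, F (Fin.cons j y) := by
  rw [← (Fin.consEquiv (fun _ : Fin (n + 1) => J)).sum_comp, Fintype.sum_prod_type]
  rfl

lemma prodMeas_cons {n : ℕ} {J : Type*} (p : Fin (n + 1) → J → ℝ) (j : J) (y : Fin n → J) :
    prodMeas p (Fin.cons j y) = p 0 j * prodMeas (fun i => p i.succ) y := by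
  simp [prodMeas, Fin.prod_univ_succ]

/-- The inequality `ReverseHolder` tensorizes. -/
lemma ReverseHolder.prodMeas {S : Type*} [Fintype S] {J : S → Type*}
    [∀ s, Fintype (J s)] {Ω : Type*} [Fintype Ω] {C : ℕ} {π : (s : S) → Ω → J s} :
    ∀ {n : ℕ} {q : Fin n → Ω → ℝ} {p : (s : S) → Fin n → J s → ℝ},
      (∀ i a, 0 ≤ q i a) → (∀ s i j, 0 ≤ p s i j) →
      (∀ i, ReverseHolder C π (q i) (fun s => p s i)) →
      ReverseHolder C (fun s (a : Fin n → Ω) i => π s (a i)) (prodMeas q)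
        (fun s => prodMeas (p s))
  | 0, q, p, _, _, _ => by
    intro f hf
    simp only [_root_.prodMeas, Finset.univ_eq_empty, Finset.prod_empty, one_mul,
      Fintype.sum_unique, Finset.prod_pow]
    refine le_of_eq (congrArg (· ^ C) (Finset.prod_congr rfl fun s _ => ?_))
    exact congrArg (f s) (Subsingleton.elim (α := Fin 0 → J s) _ _)
  | n + 1, q, p, hq, hp, h => by
    intro f hf
    have ih := ReverseHolder.prodMeas (q := fun i => q i.succ) (p := fun s i => p s i.succ)
      (fun i => hq _) (fun s i => hp _ _) (fun i => h _)
    have hpm : ∀ s y, 0 ≤ _root_.prodMeas (fun i => p s (Fin.succ i)) y :=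
      fun s y => Finset.prod_nonneg fun i _ => hp _ _ _
    simp only [sum_fin_succ_fun, prodMeas_cons, mul_assoc, ← Finset.mul_sum]
    refine (h 0 (fun s j => ∑ y, _root_.prodMeas (fun i => p s (Fin.succ i)) y
      * f s (Fin.cons j y)) fun s j => Finset.sum_nonneg fun y _ =>
        mul_nonneg (hpm s y) (hf _ _)).trans ?_
    refine Finset.sum_le_sum fun a _ => mul_le_mul_of_nonneg_left ?_ (hq 0 a)
    rw [Finset.prod_pow]
    refine (ih (fun s y => f s (Fin.cons (π s a) y)) fun s y => hf _ _).trans (le_of_eq ?_)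
    refine Finset.sum_congr rfl fun b _ => ?_
    congr 1
    refine Finset.prod_congr rfl fun s _ => ?_
    congr 2
    ext i
    refine Fin.cases ?_ (fun i => ?_) i <;> simp

/-- `ReverseHolder` applied to indicator functions. -/
lemma ReverseHolder.smeas_pow_le {S : Type*} [Fintype S] {J : S → Type*} [∀ s, Fintype (J s)]
    {Ω : Type*} [Fintype Ω] {C : ℕ} {π : (s : S) → Ω → J s} {q : Ω → ℝ} {p : (s : S) → J s → ℝ}
    (h : ReverseHolder C π q p) (hC : C ≠ 0) (A : (s : S) → Set (J s)) :
    (∏ s, smeas (p s) (A s)) ^ C ≤ smeas q {a | ∀ s, π s a ∈ A s} := by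
  classical
  refine Eq.trans_le ?_ ((h (fun s => (A s).indicator 1)
    fun s j => Set.indicator_nonneg (fun _ _ => zero_le_one) j).trans (le_of_eq ?_))
  · simp [smeas, Set.indicator_apply]
  · refine Finset.sum_congr rfl fun a _ => ?_
    by_cases ha : ∀ s, π s a ∈ A s
    · simp [ha]
    · have ha' := ha
      push Not at ha'
      obtain ⟨s, hs⟩ := ha'
      rw [Finset.prod_eq_zero (mem_univ s) (by simp [hs, hC])]
      simp [ha]

/-- **Correlation inequality for product measures (general form).** -/
theorem correlation_inequality_general :
    ∀ κ ∈ Set.Ioo (0:ℝ) 1, ∀ ε ∈ Set.Ioo (0:ℝ) 1,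
    ∃ δ₀ > (0:ℝ), ∃ n₀ : ℕ, ∀ n, n₀ ≤ n → ∀ δ ∈ Set.Ioc (0:ℝ) δ₀,
    ∀ (S : Type) [Fintype S] [DecidableEq S] (J : S → Type) [∀ s, Fintype (J s)],
    ∀ q : Fin n → (∀ s, J s) → ℝ,
      (∀ i, ∑ a : (∀ s, J s), q i a = 1) →
      (∀ i a, q i a ∈ Set.Icc κ (1 - κ)) →
    ∀ p : (s : S) → Fin n → J s → ℝ,
      (∀ s i j, p s i j =
        ∑ a : (∀ s, J s), ({a' : ∀ s', J s' | a' s = j} : Set _).indicator (q i) a) →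
    ∀ A : (s : S) → Set (Fin n → J s),
      (1 - δ) ^ n < ∏ s, smeas (prodMeas (p s)) (A s) →
      (1 - ε) ^ n <
        smeas (prodMeas q) {a : Fin n → (∀ s, J s) | ∀ s, (fun i => a i s) ∈ A s} := by
  rintro κ ⟨hκ, hκ1⟩ ε ⟨hε, hε1⟩
  obtain ⟨M, hM⟩ := exists_nat_ge (4 / κ)
  rw [div_le_iff₀' hκ] at hM
  have hM0 : 0 < M := by
    rcases Nat.eq_zero_or_pos M with rfl | h
    · norm_num at hM
    · exact h
  have hη : 1 < 1 + κ / M := by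
    have : 0 < κ / M := by positivity
    linarith
  obtain ⟨k, hk⟩ := pow_unbounded_of_one_lt (1 / κ ^ 2) hη
  have hk0 : k ≠ 0 := by
    rintro rfl
    rw [pow_zero, div_lt_one (by positivity)] at hk
    nlinarith
  have hk' : 1 ≤ κ ^ 2 * (1 + κ / M) ^ (2 * M * k) := by
    rw [← div_le_iff₀' (by positivity)]
    exact hk.le.trans (pow_le_pow_right₀ hη.le (Nat.le_mul_of_pos_left k (by positivity)))
  set C := 2 * M * k
  have hC : C ≠ 0 := by positivity
  have hC1 : (1 : ℝ) ≤ C := by exact_mod_cast Nat.one_le_iff_ne_zero.mpr hC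
  refine ⟨ε / C, by positivity, 0, ?_⟩
  intro n _ δ hδ S _ _ J _ q hq1 hq p hp A hA
  have hδC : C * δ ≤ ε := by
    rw [← le_div_iff₀' (by linarith)]
    exact hδ.2
  have hδ1 : δ < 1 := by nlinarith [hδ.1]
  have hpnn : ∀ s i j, 0 ≤ p s i j := fun s i j => by
    rw [hp]
    exact Finset.sum_nonneg fun a _ => Set.indicator_nonneg (fun b _ => hκ.le.trans (hq i b).1) a
  have hRH := ReverseHolder.prodMeas (fun i a => hκ.le.trans (hq i a).1) hpnn
    fun i => reverseHolder_coord hκ hκ1.le hM hk0 hk' (hq1 i) (fun a => (hq i a).1)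
      fun s j => hp s i j
  refine lt_of_lt_of_le ?_ (hRH.smeas_pow_le hC A)
  calc (1 - ε) ^ n ≤ ((1 - δ) ^ C) ^ n := by
        refine pow_le_pow_left₀ (by linarith) ?_ n
        have := one_add_mul_le_pow (a := -δ) (by linarith) C
        rw [← sub_eq_add_neg] at this
        linarith
    _ = ((1 - δ) ^ n) ^ C := pow_right_comm _ _ _
    _ < _ := pow_lt_pow_left₀ hA (pow_nonneg (by linarith) n) hC
end
end
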